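/- arXiv:2401.00925 — 2 statements merged into one kernel-verified Lean document; each statement's English description precedes it below -/
import Mathlib

section
/- There exists a local domain of prime characteristic which is weakly F-regular (and hence a splinter) but not catenary. -/
open IsLocalRing

/-- The `q`-th Frobenius power `I^{[q]}` of an ideal: the ideal generated by `q`-th powers of
elements of `I`. -/
def Ideal.frobPow {R : Type*} [CommRing R] (I : Ideal R) (q : ℕ) : Ideal R :=
  Ideal.span ((fun r => r ^ q) '' (I : Set R))

/-- Membership in the tight closure `I*` of an ideal `I` in a ring of characteristic `p`:
there is a `c` outside every minimal prime with `c * x^{p^e} ∈ I^{[p^e]}` for all `e ≫ 0`. -/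
def Ideal.MemTightClosure {R : Type*} [CommRing R] (p : ℕ) (I : Ideal R) (x : R) : Prop :=
  ∃ c : R, (∀ P ∈ minimalPrimes R, c ∉ P) ∧
    ∃ E : ℕ, ∀ e : ℕ, E ≤ e → c * x ^ p ^ e ∈ I.frobPow (p ^ e)

/-- A ring of characteristic `p` is weakly F-regular if every ideal is tightly closed. -/
def WeaklyFRegular (R : Type*) [CommRing R] (p : ℕ) : Prop :=
  ∀ (I : Ideal R) (x : R), I.MemTightClosure p x → x ∈ I

/-- A ring is F-regular if all of its localizations are weakly F-regular. -/
def FRegular (R : Type*) [CommRing R] (p : ℕ) : Prop :=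
  ∀ S : Submonoid R, WeaklyFRegular (Localization S) p

/-- A ring is catenary if any two saturated chains of primes with the same endpoints have
the same length. -/
def IsCatenaryRing (R : Type*) [CommRing R] : Prop :=
  ∀ (n m : ℕ) (f : Fin (n + 1) → PrimeSpectrum R) (g : Fin (m + 1) → PrimeSpectrum R),
    f 0 = g 0 → f (Fin.last n) = g (Fin.last m) →
    (∀ i : Fin n, f i.castSucc ⋖ f i.succ) → (∀ i : Fin m, g i.castSucc ⋖ g i.succ) →
    n = m

/-- `y` generates the socle of `T/I`, i.e. `(I : m) = I + (y)` and `y ∉ I`. -/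
def IsSocleGenerator {T : Type*} [CommRing T] [IsLocalRing T] (I : Ideal T) (y : T) : Prop :=
  y ∉ I ∧ I.colon (maximalIdeal T) = I ⊔ Ideal.span {y}

/-- An approximately Gorenstein sequence: a descending chain of `m`-primary ideals with
Gorenstein quotients, cofinal with the powers of `m`. -/
def IsApproxGorensteinSeq (T : Type*) [CommRing T] [IsLocalRing T] (I : ℕ → Ideal T) : Prop :=
  Antitone I ∧ (∀ s, (I s).radical = maximalIdeal T) ∧
  (∀ s, ∃ y, IsSocleGenerator (I s) y) ∧
  ∀ N : ℕ, ∃ S : ℕ, ∀ s : ℕ, S ≤ s → I s ≤ maximalIdeal T ^ N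

/-- The set `M_{I,y} = ⋃_{e ≥ 1} ⋂_{f ≥ e} (I^{[p^f]} : y^{p^f})`. -/
def MIy {T : Type*} [CommRing T] (p : ℕ) (I : Ideal T) (y : T) : Set T :=
  {c : T | ∃ e : ℕ, 1 ≤ e ∧ ∀ f : ℕ, e ≤ f → c * y ^ p ^ f ∈ I.frobPow (p ^ f)}

/-- `depth T ≥ n`: there is a regular sequence of length `n` in the maximal ideal. -/
def DepthGE (T : Type*) [CommRing T] [IsLocalRing T] (n : ℕ) : Prop :=
  ∃ rs : List T, rs.length = n ∧ (∀ x ∈ rs, x ∈ maximalIdeal T) ∧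
    RingTheory.Sequence.IsRegular T rs

/-- A Noetherian local ring is Cohen–Macaulay iff there is a regular sequence in the maximal
ideal of length equal to the Krull dimension. -/
def IsCohenMacaulayLocal (T : Type*) [CommRing T] [IsLocalRing T] : Prop :=
  ∃ rs : List T, (∀ x ∈ rs, x ∈ maximalIdeal T) ∧ RingTheory.Sequence.IsRegular T rs ∧
    (rs.length : WithBot (WithTop ℕ)) = ringKrullDim T

/-- A parameter ideal: generated by `dim T` elements, with radical the maximal ideal. -/
def IsParameterIdeal (T : Type*) [CommRing T] [IsLocalRing T] (I : Ideal T) : Prop :=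
  ∃ (n : ℕ) (x : Fin n → T), I = Ideal.span (Set.range x) ∧ I.radical = maximalIdeal T ∧
    (n : WithBot (WithTop ℕ)) = ringKrullDim T

/-- A Noetherian local ring is Gorenstein iff it is Cohen–Macaulay and every parameter ideal
is irreducible (has one-dimensional socle). -/
def IsGorensteinLocal (T : Type*) [CommRing T] [IsLocalRing T] : Prop :=
  IsCohenMacaulayLocal T ∧ ∀ I : Ideal T, IsParameterIdeal T I → ∃ y, IsSocleGenerator I y

/-- A `p`-subring of a local ring `T`: a quasi-local subring `(R, R ∩ m)` which is small,
misses `p`, and misses every associated prime of `T`. -/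
def IsPSubring (T : Type*) [CommRing T] [IsLocalRing T] (P : Ideal T) (R : Subring T) : Prop :=
  IsLocalRing R ∧ (Ideal.comap R.subtype (maximalIdeal T)).IsMaximal ∧
  (Cardinal.mk R ≤ max Cardinal.aleph0 (Cardinal.mk (ResidueField T)) ∧
    (Cardinal.mk R = max Cardinal.aleph0 (Cardinal.mk (ResidueField T)) →
      Cardinal.mk (ResidueField T) ≤ Cardinal.aleph0)) ∧
  Ideal.comap R.subtype P = ⊥ ∧
  ∀ Q ∈ associatedPrimes T T, Ideal.comap R.subtype Q = ⊥

/-- An N-subring of a local ring `T`: a quasi-local UFD `(R, R ∩ m)` inside `T` which is small,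
misses every associated prime of `T`, and such that `R ∩ J` has height at most one for every
`J ∈ Ass(T/tT)`, `t` a nonzerodivisor. -/
def IsNSubring (T : Type*) [CommRing T] [IsLocalRing T] (R : Subring T) : Prop :=
  IsLocalRing R ∧ (Ideal.comap R.subtype (maximalIdeal T)).IsMaximal ∧
  (∃ _ : IsDomain R, UniqueFactorizationMonoid R) ∧
  (Cardinal.mk R ≤ max Cardinal.aleph0 (Cardinal.mk (ResidueField T)) ∧
    (Cardinal.mk R = max Cardinal.aleph0 (Cardinal.mk (ResidueField T)) →
      Cardinal.mk (ResidueField T) ≤ Cardinal.aleph0)) ∧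
  (∀ Q ∈ associatedPrimes T T, Ideal.comap R.subtype Q = ⊥) ∧
  ∀ t ∈ nonZeroDivisors T, ∀ J ∈ associatedPrimes T (T ⧸ Ideal.span {t}),
    ∀ q0 q1 : Ideal R, q0.IsPrime → q1.IsPrime →
      ¬(q0 < q1 ∧ q1 < Ideal.comap R.subtype J)

namespace NoncatenaryFRegular

section Descent

variable {R T : Type*} [CommRing R] [CommRing T]

/-- The subring of those elements of `T` which some power of `w` carries into the image of `R`. -/
def saturation (φ : R →+* T) (w : R) : Subring T where
  carrier := {t | ∃ (N : ℕ) (r : R), φ r = φ w ^ N * t}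
  one_mem' := ⟨0, 1, by simp⟩
  zero_mem' := ⟨0, 0, by simp⟩
  mul_mem' := by
    rintro s t ⟨M, a, ha⟩ ⟨N, b, hb⟩
    exact ⟨M + N, a * b, by rw [map_mul, ha, hb]; ring⟩
  add_mem' := by
    rintro s t ⟨M, a, ha⟩ ⟨N, b, hb⟩
    exact ⟨M + N, w ^ N * a + w ^ M * b, by
      rw [map_add, map_mul, map_mul, ha, hb, map_pow, map_pow]; ring⟩
  neg_mem' := by
    rintro t ⟨N, a, ha⟩
    exact ⟨N, -a, by rw [map_neg, ha]; ring⟩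

theorem mem_saturation {φ : R →+* T} {w : R} {t : T} :
    t ∈ saturation φ w ↔ ∃ (N : ℕ) (r : R), φ r = φ w ^ N * t := Iff.rfl

theorem map_mem_saturation (φ : R →+* T) (w r : R) : φ r ∈ saturation φ w :=
  ⟨0, r, by simp⟩

/-- The corestriction of `φ` to the saturation. -/
def toSaturation (φ : R →+* T) (w : R) : R →+* saturation φ w :=
  φ.codRestrict _ (map_mem_saturation φ w)

@[simp]
theorem coe_toSaturation (φ : R →+* T) (w r : R) : (toSaturation φ w r : T) = φ r := rfl

theorem mem_saturation_of_pow_mul_mem {φ : R →+* T} {w : R} {t : T} {N : ℕ}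
    (h : φ w ^ N * t ∈ saturation φ w) : t ∈ saturation φ w := by
  obtain ⟨M, r, hr⟩ := h
  exact ⟨M + N, r, by rw [hr]; ring⟩

/-- Every `T`-linear relation between elements of `R` becomes, after multiplication by a power of
`w`, a combination of `R`-linear relations. -/
def RelationsDescend (φ : R →+* T) (w : R) : Prop :=
  ∀ (ι : Type) [Fintype ι] (f : ι → R) (t : ι → T), ∑ i, φ (f i) * t i = 0 →
    ∃ (N l : ℕ) (s : ι → Fin l → R) (y : Fin l → T),
      (∀ i, φ w ^ N * t i = ∑ j, φ (s i j) * y j) ∧ ∀ j, ∑ i, f i * s i j = 0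

theorem exists_eq_map_add_pow_mul {φ : R →+* T} {w : R}
    (hsurj : ∀ t, ∃ r t', t = φ r + φ w * t') (N : ℕ) (t : T) :
    ∃ r t', t = φ r + φ w ^ N * t' := by
  induction N with
  | zero => exact ⟨0, t, by simp⟩
  | succ N ih =>
    obtain ⟨r, t', rfl⟩ := ih
    obtain ⟨r', t'', rfl⟩ := hsurj t'
    exact ⟨r + w ^ N * r', t'', by simp only [map_add, map_mul, map_pow]; ring⟩

theorem exists_pow_mul_eq {φ : R →+* T} {w : R} {ι : Type*} [Finite ι]
    (f : ι → saturation φ w) : ∃ (N : ℕ) (r : ι → R), ∀ i, φ (r i) = φ w ^ N * f i := by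
  cases nonempty_fintype ι
  choose N r h using fun i ↦ (f i).2
  refine ⟨∑ i, N i, fun i ↦ w ^ (∑ j, N j - N i) * r i, fun i ↦ ?_⟩
  have hi : N i ≤ ∑ j, N j := Finset.single_le_sum (fun _ _ ↦ Nat.zero_le _) (Finset.mem_univ i)
  rw [map_mul, h, map_pow, ← mul_assoc, ← pow_add, Nat.sub_add_cancel hi]

/-- If relations descend from `T` to `R`, then ideals of the saturation are contracted from `T` up
to factors congruent to `1` modulo `w`. -/
theorem exists_mul_eq_sum {φ : R →+* T} {w : R} (hw : IsLeftRegular (φ w))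
    (hsurj : ∀ t, ∃ r t', t = φ r + φ w * t') (hrel : RelationsDescend φ w)
    {ι : Type} [Fintype ι] (f : ι → saturation φ w) (g : saturation φ w) (c : ι → T)
    (hg : (g : T) = ∑ i, c i * f i) :
    ∃ (α : saturation φ w) (u : T) (d : ι → saturation φ w),
      (α : T) = 1 + φ w * u ∧ α * g = ∑ i, d i * f i := by
  obtain ⟨K, r, hr⟩ := exists_pow_mul_eq (fun i : Option ι ↦ i.elim g f)
  have hr0 := hr none
  have hr1 := fun i ↦ hr (some i)
  simp only [Option.elim] at hr0 hr1
  obtain ⟨N, l, s, y, hy, hs⟩ := hrel (Option ι) r (fun i ↦ i.elim (-1) c) (by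
    simp only [Fintype.sum_option, Option.elim, hr0, hr1, hg, Finset.mul_sum]
    rw [mul_neg_one, neg_add_eq_zero]
    exact Finset.sum_congr rfl fun i _ ↦ by ring)
  have hy0 := hy none
  have hy1 := fun i ↦ hy (some i)
  simp only [Option.elim] at hy0 hy1
  choose σ y' hσ using fun j ↦ exists_eq_map_add_pow_mul hsurj (N + 1) (y j)
  have key (i : Option ι) : ∑ j, φ (s i j) * y j =
      φ (∑ j, s i j * σ j) + φ w ^ (N + 1) * ∑ j, φ (s i j) * y' j := by
    simp only [map_sum, map_mul, Finset.mul_sum, ← Finset.sum_add_distrib]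
    exact Finset.sum_congr rfl fun j _ ↦ by rw [hσ j]; ring
  rw [key] at hy0
  simp only [key] at hy1
  generalize ∑ j, φ (s none j) * y' j = u at hy0
  have hα : φ w ^ N * (1 + φ w * u) = φ (-∑ j, s none j * σ j) := by
    rw [map_neg]; linear_combination -hy0
  have hd (i : ι) : φ w ^ N * (c i - φ w * ∑ j, φ (s (some i) j) * y' j) =
      φ (∑ j, s (some i) j * σ j) := by linear_combination hy1 i
  refine ⟨⟨1 + φ w * u, mem_saturation.2 ⟨N, _, hα.symm⟩⟩, u,
    fun i ↦ ⟨_, mem_saturation.2 ⟨N, _, (hd i).symm⟩⟩, rfl, ?_⟩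
  have hsum : ∑ i, r i * ∑ j, s i j * σ j = 0 := by
    calc ∑ i, r i * ∑ j, s i j * σ j = ∑ j, (∑ i, r i * s i j) * σ j := by
          simp only [Finset.mul_sum, Finset.sum_mul, mul_assoc]
          exact Finset.sum_comm
      _ = 0 := by simp [hs]
  have hsum' := congrArg φ hsum
  rw [Fintype.sum_option, map_add, map_mul, hr0, map_zero,
    map_sum φ (fun i ↦ r (some i) * _)] at hsum'
  simp only [map_mul φ (r _), hr1] at hsum'
  apply Subtype.ext
  push_cast
  apply hw.pow (N + K)
  have e1 : φ (∑ j, s none j * σ j) = -(φ w ^ N * (1 + φ w * u)) := by rw [hα, map_neg, neg_neg]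
  rw [e1] at hsum'
  simp only [← hd] at hsum'
  beta_reduce
  have e2 : ∑ i, φ w ^ K * (f i : T) * (φ w ^ N * (c i - φ w * ∑ j, φ (s (some i) j) * y' j)) =
      φ w ^ (N + K) * ∑ i, (c i - φ w * ∑ j, φ (s (some i) j) * y' j) * f i := by
    rw [Finset.mul_sum]
    exact Finset.sum_congr rfl fun i _ ↦ by ring
  rw [← e2]
  linear_combination -hsum'

end Descent

theorem frobPow_span_range_le {A : Type*} [CommRing A] {p : ℕ} [Fact p.Prime] [CharP A p]
    {ι : Type*} [Fintype ι] (f : ι → A) (e : ℕ) :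
    (Ideal.span (Set.range f)).frobPow (p ^ e) ≤ Ideal.span (Set.range fun i ↦ f i ^ p ^ e) := by
  refine Ideal.span_le.2 ?_
  rintro _ ⟨r, hr, rfl⟩
  obtain ⟨c, rfl⟩ := Ideal.mem_span_range_iff_exists_fun.1 hr
  simp only [sum_pow_char_pow, mul_pow]
  exact Ideal.sum_mem _ fun i _ ↦ Ideal.mul_mem_left _ _ (Ideal.subset_span ⟨i, rfl⟩)

/-- Every element of `T` not killed by `ε` becomes invertible along `ε` under suitable
`p⁻ᵉ`-linear endomorphisms of `T`, for all large `e`. -/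
def HasSplittings {T V : Type*} [CommRing T] [CommRing V] (p : ℕ) (ε : T →+* V) : Prop :=
  ∀ c : T, ε c ≠ 0 → ∃ E : ℕ, ∀ e, E ≤ e → ∀ s : T, IsUnit (ε s) →
    ∃ Ψ : T →+ T, (∀ t u, Ψ (t ^ p ^ e * u) = t * Ψ u) ∧ IsUnit (ε (Ψ (s * c)))

section LocalRing

variable {R T V : Type} [CommRing R] [CommRing T] [CommRing V] [IsLocalRing V]

/-- The hypotheses under which the localized saturation inherits good properties from `T`. -/
structure IsDescentDatum (φ : R →+* T) (ε : T →+* V) (w : R) : Prop where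
  regular : IsLeftRegular (φ w)
  surj : ∀ t, ∃ r t', t = φ r + φ w * t'
  rel : RelationsDescend φ w
  inj : Function.Injective (ε.comp φ)
  mem : ε (φ w) ∈ maximalIdeal V

/-- The prime ideal of the saturation lying under the maximal ideal of `V`. -/
def centre (φ : R →+* T) (ε : T →+* V) (w : R) : Ideal (saturation φ w) :=
  (maximalIdeal V).comap (ε.comp (saturation φ w).subtype)

instance (φ : R →+* T) (ε : T →+* V) (w : R) : (centre φ ε w).IsPrime :=
  Ideal.IsPrime.comap _

variable {φ : R →+* T} {ε : T →+* V} {w : R}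

theorem mem_centre_primeCompl {t : saturation φ w} :
    t ∈ (centre φ ε w).primeCompl ↔ IsUnit (ε t) := by
  simp [centre, Ideal.mem_primeCompl_iff]

namespace IsDescentDatum

theorem injective_saturation (h : IsDescentDatum φ ε w) :
    Function.Injective (ε.comp (saturation φ w).subtype) := by
  rw [injective_iff_map_eq_zero]
  rintro ⟨t, ht⟩ h0
  obtain ⟨N, r, hr⟩ := mem_saturation.1 ht
  have h0 : ε t = 0 := h0
  have hr0 : r = 0 := by
    refine (injective_iff_map_eq_zero _).1 h.inj r ?_
    rw [RingHom.comp_apply, hr, map_mul, h0, mul_zero]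
  refine Subtype.ext (h.regular.pow N ?_)
  rw [hr0, map_zero] at hr
  simp [← hr]

theorem isDomain_saturation (h : IsDescentDatum φ ε w) [IsDomain V] : IsDomain (saturation φ w) :=
  h.injective_saturation.isDomain

theorem isUnit_of_eq_one_add_mul (h : IsDescentDatum φ ε w) {t u : T}
    (ht : t = 1 + φ w * u) : IsUnit (ε t) := by
  by_contra hn
  have h1 : ε t ∈ maximalIdeal V := hn
  rw [ht, map_add, map_mul, map_one] at h1
  exact (Ideal.ne_top_iff_one _).1 (maximalIdeal.isMaximal V).ne_top
    ((Ideal.add_mem_iff_left _ (Ideal.mul_mem_right _ _ h.mem)).1 h1)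

variable {A : Type} [CommRing A] [Algebra (saturation φ w) A]
  [IsLocalization.AtPrime A (centre φ ε w)]

theorem isDomain (h : IsDescentDatum φ ε w) [IsDomain V] : IsDomain A :=
  have := h.isDomain_saturation
  IsLocalization.isDomain_of_le_nonZeroDivisors A (centre φ ε w).primeCompl_le_nonZeroDivisors

theorem algebraMap_injective (h : IsDescentDatum φ ε w) [IsDomain V] :
    Function.Injective (algebraMap (saturation φ w) A) :=
  have := h.isDomain_saturation
  IsLocalization.injective A (centre φ ε w).primeCompl_le_nonZeroDivisors

variable (ε) in
theorem isUnit_algebraMap {t : saturation φ w} (ht : IsUnit (ε t)) :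
    IsUnit (algebraMap (saturation φ w) A t) :=
  IsLocalization.map_units A (⟨t, mem_centre_primeCompl.2 ht⟩ : (centre φ ε w).primeCompl)

theorem exists_generators (h : IsDescentDatum φ ε w) [IsNoetherianRing T] (I : Ideal A) :
    ∃ (ι : Type) (_ : Fintype ι) (f : ι → saturation φ w),
      I = Ideal.span (Set.range fun i ↦ algebraMap _ A (f i)) := by
  set J := I.comap (algebraMap (saturation φ w) A) with hJ
  obtain ⟨s, hs, hspan⟩ := (Submodule.fg_span_iff_fg_span_finset_subset _).1
    (IsNoetherian.noetherian (Submodule.span T ((saturation φ w).subtype '' J)))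
  choose f hfJ hf using fun i : s ↦ hs i.2
  refine ⟨s, inferInstance, f, le_antisymm ?_ ?_⟩
  · rw [← IsLocalization.map_under (centre φ ε w).primeCompl A I]
    refine Ideal.map_le_iff_le_comap.2 fun g hg ↦ ?_
    have hgT : (g : T) ∈ Submodule.span T (Set.range fun i : s ↦ (f i : T)) := by
      have : Set.range (fun i : s ↦ (f i : T)) = s := by
        have hf' (i : s) : (f i : T) = i := hf i
        simp [hf']
      rw [this, ← hspan]
      exact Submodule.subset_span ⟨g, hg, rfl⟩
    obtain ⟨c, hc⟩ := Ideal.mem_span_range_iff_exists_fun.1 hgT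
    obtain ⟨α, u, d, hα, hd⟩ := exists_mul_eq_sum h.regular h.surj h.rel f g c hc.symm
    refine Ideal.mem_comap.2
      ((Ideal.unit_mul_mem_iff_mem _ (isUnit_algebraMap ε (h.isUnit_of_eq_one_add_mul hα))).1 ?_)
    rw [← map_mul, hd, map_sum]
    refine Ideal.sum_mem _ fun i _ ↦ ?_
    rw [map_mul]
    exact Ideal.mul_mem_left _ _ (Ideal.subset_span ⟨i, rfl⟩)
  · refine Ideal.span_le.2 ?_
    rintro _ ⟨i, rfl⟩
    exact hfJ i

theorem isNoetherianRing (h : IsDescentDatum φ ε w) [IsNoetherianRing T] : IsNoetherianRing A := by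
  refine (isNoetherianRing_iff_ideal_fg A).2 fun I ↦ ?_
  obtain ⟨ι, _, f, rfl⟩ := h.exists_generators I
  exact Submodule.fg_span (Set.finite_range _)

theorem weaklyFRegular (h : IsDescentDatum φ ε w) [IsDomain V] [IsNoetherianRing T]
    {p : ℕ} [Fact p.Prime] [CharP A p] (hsplit : HasSplittings p ε) : WeaklyFRegular A p := by
  have := h.isDomain (A := A)
  rintro I x ⟨c, hc, E, hE⟩
  have hc0 : c ≠ 0 := fun h0 ↦
    hc ⊥ (by rw [IsDomain.minimalPrimes_eq_singleton_bot]; rfl) (by simp [h0])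
  obtain ⟨ι, _, f, rfl⟩ := h.exists_generators I
  obtain ⟨c, b, rfl⟩ := IsLocalization.exists_mk'_eq (centre φ ε w).primeCompl c
  obtain ⟨x, a, rfl⟩ := IsLocalization.exists_mk'_eq (centre φ ε w).primeCompl x
  have hεc : ε c ≠ 0 := by
    intro h0
    have : c = 0 := h.injective_saturation (by simpa using h0)
    exact hc0 (by simp [this])
  obtain ⟨E', hE'⟩ := hsplit c hεc
  set e := max E E'
  have hmem := frobPow_span_range_le _ _ (hE e (le_max_left _ _))
  have hmem' : algebraMap _ A (c * x ^ p ^ e) ∈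
      (Ideal.span (Set.range fun i ↦ f i ^ p ^ e)).map (algebraMap _ A) := by
    rw [Ideal.map_span, ← Set.range_comp]
    have hcx : algebraMap _ A (c * x ^ p ^ e) = algebraMap (saturation φ w) A (b * a ^ p ^ e) *
        (IsLocalization.mk' A c b * IsLocalization.mk' A x a ^ p ^ e) := by
      simp only [map_mul, map_pow]
      rw [mul_mul_mul_comm, ← mul_pow, IsLocalization.mk'_spec', IsLocalization.mk'_spec']
    rw [hcx]
    simpa [Function.comp_def] using Ideal.mul_mem_left _ _ hmem
  obtain ⟨s, hs, hsmem⟩ :=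
    (IsLocalization.algebraMap_mem_map_algebraMap_iff (centre φ ε w).primeCompl A _ _).1 hmem'
  obtain ⟨d, hd⟩ := Ideal.mem_span_range_iff_exists_fun.1 hsmem
  obtain ⟨Ψ, hΨ, hunit⟩ := hE' e (le_max_right _ _) s (mem_centre_primeCompl.1 hs)
  have hT : Ψ (s * c) * x = ∑ i, Ψ (d i) * f i := by
    have := congrArg (fun t : saturation φ w ↦ Ψ t) hd
    push_cast at this
    rw [map_sum, show (s : T) * (c * x ^ p ^ e) = x ^ p ^ e * (s * c) by ring, hΨ] at this
    rw [mul_comm, ← this]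
    exact Finset.sum_congr rfl fun i _ ↦ by rw [mul_comm, hΨ, mul_comm]
  obtain ⟨r, t', hrt⟩ := h.surj (Ψ (s * c))
  obtain ⟨α, u, d', hα, hd'⟩ := exists_mul_eq_sum h.regular h.surj h.rel
    (fun i : Option ι ↦ i.elim (toSaturation φ w w * x) f) (toSaturation φ w r * x)
    (fun i ↦ i.elim (-t') fun i ↦ Ψ (d i)) (by
      simp only [Fintype.sum_option, Option.elim, Subring.coe_mul, coe_toSaturation, ← hT, hrt]
      ring)
  simp only [Fintype.sum_option, Option.elim] at hd'
  have hβ : (α * toSaturation φ w r - d' none * toSaturation φ w w) * x =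
      ∑ i, d' (some i) * f i := by linear_combination hd'
  have hβu : IsUnit (ε ((α * toSaturation φ w r - d' none * toSaturation φ w w :
      saturation φ w) : T)) := by
    have : ((α * toSaturation φ w r - d' none * toSaturation φ w w : saturation φ w) : T) =
        Ψ (s * c) + φ w * (u * φ r - t' - d' none) := by
      simp only [AddSubgroupClass.coe_sub, Subring.coe_mul, coe_toSaturation, hα, hrt]
      ring
    rw [this, map_add, map_mul ε (φ w)]
    by_contra hn
    exact ((Ideal.add_mem_iff_left _ (Ideal.mul_mem_right _ _ h.mem)).1
      ((mem_maximalIdeal _).2 hn)) hunit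
  refine IsLocalization.mk'_mem_iff.2
    ((Ideal.unit_mul_mem_iff_mem _ (isUnit_algebraMap ε hβu)).1 ?_)
  rw [← map_mul, hβ, map_sum]
  refine Ideal.sum_mem _ fun i _ ↦ ?_
  rw [map_mul]
  exact Ideal.mul_mem_left _ _ (Ideal.subset_span ⟨i, rfl⟩)

end IsDescentDatum

end LocalRing

section Primes

variable {R A : Type*} [CommRing R] [CommRing A]

/-- Up to units and powers of the image of `w`, every element of `A` comes from `R`. -/
def IsDenseAway (ψ : R →+* A) (w : R) : Prop :=
  ∀ a : A, ∃ (N : ℕ) (v : Aˣ) (r : R), ψ r = ψ w ^ N * (v * a)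

theorem IsDenseAway.le_of_comap_le {ψ : R →+* A} {w : R} (h : IsDenseAway ψ w) {P Q : Ideal A}
    [Q.IsPrime] (hw : ψ w ∉ Q) (hPQ : P.comap ψ ≤ Q.comap ψ) : P ≤ Q := by
  intro a ha
  obtain ⟨N, v, r, hr⟩ := h a
  have h1 : r ∈ P.comap ψ := by
    rw [Ideal.mem_comap, hr]
    exact Ideal.mul_mem_left _ _ (Ideal.mul_mem_left _ _ ha)
  have h2 : ψ r ∈ Q := hPQ h1
  rw [hr] at h2
  exact (Ideal.unit_mul_mem_iff_mem _ v.isUnit).1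
    ((‹Q.IsPrime›.mem_or_mem h2).resolve_left fun h ↦ hw (‹Q.IsPrime›.mem_of_pow_mem _ h))

theorem IsDenseAway.comap_lt_comap {ψ : R →+* A} {w : R} (h : IsDenseAway ψ w) {P Q : Ideal A}
    [P.IsPrime] (hw : ψ w ∉ P) (hPQ : P < Q) : P.comap ψ < Q.comap ψ :=
  lt_of_le_not_ge (Ideal.comap_mono hPQ.le) fun hle ↦ hPQ.not_ge (h.le_of_comap_le hw hle)

theorem IsDenseAway.covBy_of_height {ψ : R →+* A} {w : R} (h : IsDenseAway ψ w)
    {P Q : PrimeSpectrum A} (hw : ψ w ∉ Q.asIdeal) (hPQ : P < Q) (n : ℕ)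
    (hP : n ≤ (P.asIdeal.comap ψ).height) (hQ : (Q.asIdeal.comap ψ).height ≤ n + 1) : P ⋖ Q := by
  refine ⟨hPQ, fun P' h1 h2 ↦ ?_⟩
  have hP' := h.comap_lt_comap (fun hm ↦ hw (h2.le (h1.le hm))) h1
  have hQ' := h.comap_lt_comap (fun hm ↦ hw (h2.le hm)) h2
  have e1 := Ideal.height_add_one_le_of_lt_of_isPrime hP'
  have e2 := Ideal.height_add_one_le_of_lt_of_isPrime hQ'
  have : ((n + 2 : ℕ) : ℕ∞) ≤ ((n + 1 : ℕ) : ℕ∞) := by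
    push_cast
    calc (n : ℕ∞) + 2 = n + 1 + 1 := by rw [add_assoc]; rfl
      _ ≤ (P.asIdeal.comap ψ).height + 1 + 1 := by gcongr
      _ ≤ _ := (add_le_add_left e1 1).trans (e2.trans hQ)
  rw [Nat.cast_le] at this
  omega

theorem covBy_closedPoint [IsLocalRing A] [IsNoetherianRing A] {W : A} {q : PrimeSpectrum A}
    (hW : W ∉ q.asIdeal) (hm : maximalIdeal A = q.asIdeal ⊔ Ideal.span {W}) :
    q ⋖ closedPoint A := by
  have hWm : W ∈ maximalIdeal A := by
    rw [hm]; exact Ideal.mem_sup_right (Ideal.mem_span_singleton_self W)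
  refine ⟨lt_of_le_of_ne (le_maximalIdeal q.2.ne_top) fun h ↦ hW (h ▸ hWm), fun P h1 h2 ↦ ?_⟩
  have hWP : W ∉ P.asIdeal := fun hmem ↦ h2.not_ge (by
    change maximalIdeal A ≤ P.asIdeal
    rw [hm, sup_le_iff, Ideal.span_singleton_le_iff_mem]
    exact ⟨h1.le, hmem⟩)
  refine h1.not_ge (Submodule.le_of_le_smul_of_le_jacobson_bot (I := Ideal.span {W})
    (IsNoetherian.noetherian P.asIdeal)
    (by rwa [IsLocalRing.jacobson_eq_maximalIdeal ⊥ bot_ne_top,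
      Ideal.span_singleton_le_iff_mem]) fun x hx ↦ ?_)
  have hx' : x ∈ maximalIdeal A := h2.le hx
  rw [hm] at hx'
  obtain ⟨y, hy, z, hz, rfl⟩ := Submodule.mem_sup.1 hx'
  obtain ⟨z, rfl⟩ := Ideal.mem_span_singleton'.1 hz
  have : z * W ∈ P.asIdeal := (Ideal.add_mem_iff_right _ (h1.le hy)).1 hx
  refine Submodule.add_mem_sup hy ?_
  rw [mul_comm]
  exact Submodule.smul_mem_smul (Ideal.mem_span_singleton_self W)
    ((P.2.mem_or_mem this).resolve_right hWP)

theorem not_isCatenaryRing_of_covBy {a b c d e : PrimeSpectrum A} (hab : a ⋖ b) (hbe : b ⋖ e)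
    (hac : a ⋖ c) (hcd : c ⋖ d) (hde : d ⋖ e) : ¬ IsCatenaryRing A := by
  intro h
  have := h 2 3 ![a, b, e] ![a, c, d, e] rfl rfl
    (by intro i; fin_cases i <;> assumption) (by intro i; fin_cases i <;> assumption)
  omega

end Primes

end NoncatenaryFRegular

namespace NoncatenaryFRegular

section Flatness

open MvPolynomial

theorem flat_of_injective_of_field {R K : Type*} [CommRing R] [IsDomain R] [Field K]
    {f : R →+* K} (hf : Function.Injective f) : f.Flat := by
  have : f = (IsFractionRing.lift (K := FractionRing R) hf).comp (algebraMap R _) := by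
    ext r; simp
  rw [this]
  exact (RingHom.flat_algebraMap_iff.2 inferInstance).comp
    (RingHom.Flat.of_isField (Field.toIsField _) _)

attribute [local instance] MvPolynomial.algebraMvPolynomial in
theorem flat_mvPolynomial_map {R S : Type} [CommRing R] [CommRing S] {f : R →+* S}
    (hf : f.Flat) (σ : Type) : (MvPolynomial.map (σ := σ) f).Flat := by
  algebraize_only [f]
  exact RingHom.Flat.isStableUnderBaseChange R S (MvPolynomial σ R) (MvPolynomial σ S)
    (RingHom.flat_algebraMap_iff.2 hf)

theorem bijective_aeval_X_add_C {S σ : Type*} [CommRing S] (a : σ → S) :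
    Function.Bijective (aeval (R := S) fun i ↦ (X i + C (a i) : MvPolynomial σ S)) := by
  have h (b c : σ → S) (hbc : ∀ i, b i + c i = 0) (f : MvPolynomial σ S) :
      aeval (fun i ↦ (X i + C (b i) : MvPolynomial σ S))
        (aeval (fun i ↦ (X i + C (c i) : MvPolynomial σ S)) f) = f := by
    rw [← AlgHom.comp_apply, ← AlgHom.id_apply (R := S) f]
    congr 1
    refine MvPolynomial.algHom_ext fun i ↦ ?_
    simp [algebraMap_eq, add_assoc, ← C_add, hbc]
  exact Function.bijective_iff_has_inverse.2
    ⟨aeval fun i ↦ X i + C (-a i), h _ _ (by simp), h _ _ (by simp)⟩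

/-- Send the variables in `σ` to translates of themselves and those in `τ` to constants. -/
noncomputable def translateEval {k S : Type*} (σ τ : Type*) [CommRing k] [CommRing S]
    (f : k →+* S) (a : σ ⊕ τ → S) : MvPolynomial (σ ⊕ τ) k →+* MvPolynomial σ S :=
  eval₂Hom (C.comp f) (Sum.elim (fun i ↦ X i + C (a (.inl i))) fun j ↦ C (a (.inr j)))

theorem translateEval_flat {k K σ τ : Type} [CommRing k] [IsDomain k] [Field K] (f : k →+* K)
    (a : σ ⊕ τ → K) (ha : Function.Injective (eval₂Hom f fun j ↦ a (.inr j))) :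
    (translateEval σ τ f a).Flat := by
  have : translateEval σ τ f a = ((aeval (R := K) fun i ↦
      (X i + C (a (.inl i)) : MvPolynomial σ K)).toRingHom.comp
      (MvPolynomial.map (eval₂Hom f fun j ↦ a (.inr j)))).comp
      (sumAlgEquiv k σ τ : _ →+* MvPolynomial σ (MvPolynomial τ k)) := by
    refine MvPolynomial.ringHom_ext (fun r ↦ ?_) ?_
    · simp [translateEval, algebraMap_eq]
    · rintro (i | j) <;> simp [translateEval, algebraMap_eq]
  rw [this]
  exact (RingHom.Flat.of_bijective (sumAlgEquiv k σ τ).bijective).comp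
    ((flat_mvPolynomial_map (flat_of_injective_of_field ha) σ).comp
      (RingHom.Flat.of_bijective (bijective_aeval_X_add_C _)))

theorem flat_prod (R M N : Type*) [CommRing R] [AddCommGroup M] [AddCommGroup N] [Module R M]
    [Module R N] [Module.Flat R M] [Module.Flat R N] : Module.Flat R (M × N) := by
  refine Module.Flat.iff_rTensor_injectiveₛ.2 fun P _ _ Q ↦ ?_
  have h : (TensorProduct.prodRight R R P M N).toLinearMap ∘ₗ Q.subtype.rTensor (M × N) =
      (Q.subtype.rTensor M).prodMap (Q.subtype.rTensor N) ∘ₗ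
        (TensorProduct.prodRight R R Q M N).toLinearMap :=
    TensorProduct.ext' fun x y ↦ by simp
  have hinj := ((Module.Flat.rTensor_preserves_injective_linearMap (M := M) Q.subtype
    Q.injective_subtype).prodMap (Module.Flat.rTensor_preserves_injective_linearMap (M := N)
    Q.subtype Q.injective_subtype)).comp (TensorProduct.prodRight R R Q M N).injective
  refine Function.Injective.of_comp (f := TensorProduct.prodRight R R P M N) ?_
  convert hinj using 1
  exact congrArg DFunLike.coe h

/-- The kernel of a surjection between flat modules satisfies the equational criterion. -/
theorem exists_of_flat_of_surjective {R M N : Type*} [CommRing R] [AddCommGroup M] [AddCommGroup N]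
    [Module R M] [Module R N] [Module.Flat R M] [Module.Flat R N] (h : M →ₗ[R] N)
    (hh : Function.Surjective h) {ι : Type*} [Fintype ι] (f : ι → R) (x : ι → M)
    (hx : ∀ i, h (x i) = 0) (hfx : ∑ i, f i • x i = 0) :
    ∃ (l : ℕ) (s : ι → Fin l → R) (y : Fin l → M), (∀ j, h (y j) = 0) ∧
      (∀ i, x i = ∑ j, s i j • y j) ∧ ∀ j, ∑ i, f i * s i j = 0 := by
  classical
  obtain ⟨l, s, y, hy, hs⟩ := Module.Flat.isTrivialRelation_of_sum_smul_eq_zero hfx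
  obtain ⟨n, a, z, hz, ha⟩ := Module.Flat.exists_factorization_of_comp_eq_zero_of_free
    (f := Fintype.linearCombination R s) (x := Fintype.linearCombination R (h ∘ y)) (by
      refine LinearMap.pi_ext' fun i ↦ LinearMap.ext_ring ?_
      simp only [LinearMap.comp_apply, LinearMap.single_apply, LinearMap.zero_apply,
        Fintype.linearCombination_apply_single, one_smul]
      rw [Fintype.linearCombination_apply]
      simpa only [hy, map_sum, map_smul, Function.comp_apply] using hx i)
  choose μ hμ using fun j ↦ hh (z (Finsupp.single j 1))
  have hz' (j : Fin l) : h (y j) = ∑ m, a (Pi.single j 1) m • h (μ m) := by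
    have := congrArg (fun g ↦ g (Pi.single j 1)) hz
    simp only [Fintype.linearCombination_apply_single, one_smul, Function.comp_apply,
      LinearMap.comp_apply] at this
    rw [this]
    conv_lhs => rw [← Finsupp.univ_sum_single (a (Pi.single j 1))]
    rw [map_sum]
    refine Finset.sum_congr rfl fun m _ ↦ ?_
    rw [hμ, ← map_smul, Finsupp.smul_single, smul_eq_mul, mul_one]
  have ha' (i : ι) (m : Fin n) : ∑ j, s i j * a (Pi.single j 1) m = 0 := by
    have := congrArg (fun g ↦ g (Pi.single i 1) m) ha
    simp only [LinearMap.comp_apply, Fintype.linearCombination_apply_single, one_smul,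
      LinearMap.zero_apply, Finsupp.coe_zero, Pi.zero_apply] at this
    rw [← this]
    conv_rhs => rw [pi_eq_sum_univ' (s i)]
    simp [Finsupp.finsetSum_apply]
  refine ⟨l, s, fun j ↦ y j - ∑ m, a (Pi.single j 1) m • μ m, fun j ↦ ?_, fun i ↦ ?_, hs⟩
  · simp [hz']
  · simp only [smul_sub, Finset.sum_sub_distrib, Finset.smul_sum, ← mul_smul]
    rw [Finset.sum_comm]
    simp [← Finset.sum_smul, ha', hy]

/-- A fibre product of flat algebras, over which the relations are glued along a flat algebra,
satisfies the equational criterion. -/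
theorem exists_of_flat_fibreProduct {R B₁ B₂ L : Type*} [CommRing R] [CommRing B₁] [CommRing B₂]
    [CommRing L] {α₁ : R →+* B₁} {α₂ : R →+* B₂} {h₁ : B₁ →+* L} {h₂ : B₂ →+* L}
    (hα₁ : α₁.Flat) (hα₂ : α₂.Flat) (hL : (h₁.comp α₁).Flat) (hcomm : h₁.comp α₁ = h₂.comp α₂)
    (hh : Function.Surjective h₁) {ι : Type*} [Fintype ι] (f : ι → R) (x : ι → B₁ × B₂)
    (hx : ∀ i, h₁ (x i).1 = h₂ (x i).2) (hfx : ∑ i, α₁.prod α₂ (f i) * x i = 0) :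
    ∃ (l : ℕ) (s : ι → Fin l → R) (y : Fin l → B₁ × B₂), (∀ j, h₁ (y j).1 = h₂ (y j).2) ∧
      (∀ i, x i = ∑ j, α₁.prod α₂ (s i j) * y j) ∧ ∀ j, ∑ i, f i * s i j = 0 := by
  let := α₁.toAlgebra
  let := α₂.toAlgebra
  let := (h₁.comp α₁).toAlgebra
  have : Module.Flat R B₁ := hα₁
  have : Module.Flat R B₂ := hα₂
  have : Module.Flat R L := hL
  let k₁ : B₁ →ₐ[R] L := { h₁ with commutes' := fun r ↦ rfl }
  let k₂ : B₂ →ₐ[R] L := { h₂ with commutes' := fun r ↦ (congrArg (· r) hcomm).symm }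
  have hsmul (r : R) (b : B₁ × B₂) : r • b = α₁.prod α₂ r * b := Algebra.smul_def r b
  have := flat_prod R B₁ B₂
  have := exists_of_flat_of_surjective
    (k₁.toLinearMap ∘ₗ LinearMap.fst R B₁ B₂ - k₂.toLinearMap ∘ₗ LinearMap.snd R B₁ B₂)
    (fun z ↦ by
      obtain ⟨b, rfl⟩ := hh z
      exact ⟨(b, 0), by simp [k₁]⟩) f x (fun i ↦ sub_eq_zero.2 (hx i)) (by simpa only [hsmul])
  obtain ⟨l, s, y, hy, hs, hfs⟩ := this
  exact ⟨l, s, y, fun j ↦ sub_eq_zero.1 (hy j), by simpa only [hsmul] using hs, hfs⟩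

end Flatness

end NoncatenaryFRegular

namespace NoncatenaryFRegular

open MvPolynomial

section TranslateEval

variable {k S σ τ : Type*} [CommRing k] [CommRing S] (f : k →+* S) (a : σ ⊕ τ → S)

@[simp]
theorem translateEval_C (r : k) : translateEval σ τ f a (C r) = C (f r) := by
  simp [translateEval]

@[simp]
theorem translateEval_X_inl (i : σ) :
    translateEval σ τ f a (X (.inl i)) = X i + C (a (.inl i)) := by
  simp [translateEval]

@[simp]
theorem translateEval_X_inr (j : τ) : translateEval σ τ f a (X (.inr j)) = C (a (.inr j)) := by
  simp [translateEval]

theorem translateEval_rename_inl (r : MvPolynomial σ k) :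
    translateEval σ τ f a (rename .inl r) =
      aeval (R := S) (fun i ↦ (X i + C (a (.inl i)) : MvPolynomial σ S)) (MvPolynomial.map f r) := by
  rw [aeval_def, eval₂_map, algebraMap_eq, translateEval, coe_eval₂Hom, eval₂_rename]
  rfl

theorem translateEval_rename_inr (r : MvPolynomial τ k) :
    translateEval σ τ f a (rename .inr r) = C (eval₂ f (fun j ↦ a (.inr j)) r) := by
  simp [translateEval, eval₂_rename, Function.comp_def, eval₂_comp_left]

theorem constantCoeff_comp_translateEval :
    constantCoeff.comp (translateEval σ τ f a) = eval₂Hom f a := by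
  refine MvPolynomial.ringHom_ext (fun r ↦ by simp) ?_
  rintro (i | j) <;> simp

theorem constantCoeff_translateEval (r : MvPolynomial (σ ⊕ τ) k) :
    constantCoeff (translateEval σ τ f a r) = eval₂Hom f a r :=
  congrArg (· r) (constantCoeff_comp_translateEval f a)

end TranslateEval

section Glued

/-- Pairs of polynomials with a common constant term: the coordinate ring of two affine spaces
meeting in a point. -/
noncomputable def Glued (σ τ V : Type*) [CommRing V] : Subring (MvPolynomial σ V × MvPolynomial τ V) :=
  ((constantCoeff (R := V) (σ := σ)).comp (RingHom.fst _ _)).eqLocus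
    (constantCoeff.comp (RingHom.snd _ _))

variable {k V σ τ : Type*} [CommRing k] [CommRing V]

theorem mem_glued {t : MvPolynomial σ V × MvPolynomial τ V} :
    t ∈ Glued σ τ V ↔ constantCoeff t.1 = constantCoeff t.2 := Iff.rfl

/-- The common constant term. -/
noncomputable def gluedCoeff (σ τ V : Type*) [CommRing V] : Glued σ τ V →+* V :=
  constantCoeff.comp ((RingHom.fst _ _).comp (Glued σ τ V).subtype)

theorem gluedCoeff_apply (t : Glued σ τ V) : gluedCoeff σ τ V t = constantCoeff t.1.1 := rfl

theorem gluedCoeff_apply' (t : Glued σ τ V) : gluedCoeff σ τ V t = constantCoeff t.1.2 := t.2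

variable (f : k →+* V) (a : σ ⊕ τ → V)

/-- Evaluate a polynomial in both sets of variables at translates of the coordinate functions on
the two affine spaces. -/
noncomputable def toGlued : MvPolynomial (σ ⊕ τ) k →+* Glued σ τ V :=
  ((translateEval σ τ f a).prod ((translateEval τ σ f (a ∘ Sum.swap)).comp
    (rename Sum.swap).toRingHom)).codRestrict _ fun r ↦ mem_glued.2 (by
      simp [constantCoeff_translateEval, eval₂_rename, Function.comp_assoc])

theorem toGlued_fst (r : MvPolynomial (σ ⊕ τ) k) :
    (toGlued f a r).1.1 = translateEval σ τ f a r := rfl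

theorem toGlued_snd (r : MvPolynomial (σ ⊕ τ) k) :
    (toGlued f a r).1.2 = translateEval τ σ f (a ∘ Sum.swap) (rename Sum.swap r) := rfl

theorem gluedCoeff_comp_toGlued : (gluedCoeff σ τ V).comp (toGlued f a) = eval₂Hom f a :=
  constantCoeff_comp_translateEval f a

theorem gluedCoeff_toGlued (r : MvPolynomial (σ ⊕ τ) k) :
    gluedCoeff σ τ V (toGlued f a r) = eval₂Hom f a r :=
  constantCoeff_translateEval f a r

theorem coe_toGlued_C (r : k) : (toGlued f a (C r) : MvPolynomial σ V × MvPolynomial τ V) = (C (f r), C (f r)) := by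
  ext1
  · simp [toGlued_fst]
  · simp [toGlued_snd]

theorem coe_toGlued_rename_inl (r : MvPolynomial σ k) :
    (toGlued f a (rename .inl r) : MvPolynomial σ V × MvPolynomial τ V) =
      (aeval (R := V) (fun i ↦ (X i + C (a (.inl i)) : MvPolynomial σ V)) (MvPolynomial.map f r),
        C (eval₂ f (fun i ↦ a (.inl i)) r)) := by
  ext1
  · rw [toGlued_fst, translateEval_rename_inl]
  · rw [toGlued_snd, rename_rename]
    exact translateEval_rename_inr ..

theorem coe_toGlued_rename_inr (r : MvPolynomial τ k) :
    (toGlued f a (rename .inr r) : MvPolynomial σ V × MvPolynomial τ V) =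
      (C (eval₂ f (fun i ↦ a (.inr i)) r),
       aeval (R := V) (fun i ↦ (X i + C (a (.inr i)) : MvPolynomial τ V)) (MvPolynomial.map f r)) := by
  ext1
  · rw [toGlued_fst, translateEval_rename_inr]
  · rw [toGlued_snd, rename_rename]
    exact translateEval_rename_inl ..

theorem toGlued_id_zero_surjective :
    Function.Surjective (toGlued (σ := σ) (τ := τ) (RingHom.id V) 0) := by
  intro t
  refine ⟨rename .inl t.1.1 + rename .inr t.1.2 - C (gluedCoeff σ τ V t), Subtype.ext ?_⟩
  rw [map_sub, map_add]
  simp only [AddSubgroupClass.coe_sub, Subring.coe_add, coe_toGlued_rename_inl,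
    coe_toGlued_rename_inr, coe_toGlued_C]
  ext1
  · simp [gluedCoeff_apply', MvPolynomial.map_id]
  · simp [gluedCoeff_apply, MvPolynomial.map_id]

instance [IsNoetherianRing V] [Finite σ] [Finite τ] : IsNoetherianRing (Glued σ τ V) :=
  isNoetherianRing_of_surjective _ _ _ toGlued_id_zero_surjective

theorem exists_eq_map_add_C_mul {f : k →+* V} {w : k} (hf : ∀ v, ∃ r v', v = f r + f w * v')
    (g : MvPolynomial σ V) : ∃ r g', g = MvPolynomial.map f r + C (f w) * g' := by
  induction g using MvPolynomial.induction_on with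
  | C v =>
    obtain ⟨r, v', rfl⟩ := hf v
    exact ⟨C r, C v', by simp⟩
  | add g h hg hh =>
    obtain ⟨r, g', rfl⟩ := hg
    obtain ⟨s, h', rfl⟩ := hh
    exact ⟨r + s, g' + h', by rw [map_add]; ring⟩
  | mul_X g i hg =>
    obtain ⟨r, g', rfl⟩ := hg
    exact ⟨r * X i, g' * X i, by rw [map_mul, map_X]; ring⟩

theorem exists_eq_aeval_map_add_C_mul {f : k →+* V} {w : k}
    (hf : ∀ v, ∃ r v', v = f r + f w * v') (b : σ → V) (g : MvPolynomial σ V) :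
    ∃ r g', g = aeval (R := V) (fun i ↦ (X i + C (b i) : MvPolynomial σ V)) (MvPolynomial.map f r) +
      C (f w) * g' := by
  obtain ⟨g, rfl⟩ := (bijective_aeval_X_add_C b).2 g
  obtain ⟨r, g', rfl⟩ := exists_eq_map_add_C_mul hf g
  exact ⟨r, _, by rw [map_add, map_mul, algHom_C, algebraMap_eq]⟩

theorem exists_eq_toGlued_add_mul {f : k →+* V} {w : k}
    (hf : ∀ v, ∃ r v', v = f r + f w * v') (t : Glued σ τ V) :
    ∃ r t', t = toGlued f a r + toGlued f a (C w) * t' := by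
  obtain ⟨⟨g, h⟩, ht⟩ := t
  obtain ⟨r, g', rfl⟩ := exists_eq_aeval_map_add_C_mul hf (fun i ↦ a (.inl i)) g
  obtain ⟨s, h', rfl⟩ := exists_eq_aeval_map_add_C_mul hf (fun i ↦ a (.inr i)) h
  obtain ⟨c, v, hv⟩ := hf (eval₂ f (fun i ↦ a (.inr i)) s)
  have h1 := (toGlued f a (rename .inl r)).2
  have h2 := (toGlued f a (rename .inr s)).2
  rw [coe_toGlued_rename_inl, mem_glued, constantCoeff_C] at h1
  rw [coe_toGlued_rename_inr, mem_glued, constantCoeff_C] at h2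
  rw [mem_glued, map_add, map_add, map_mul, map_mul, h1, ← h2, constantCoeff_C,
    constantCoeff_C, hv] at ht
  have hv' : eval₂ f (fun i ↦ a (.inl i)) r =
      f c + f w * (v + constantCoeff h' - constantCoeff g') := by
    linear_combination ht
  refine ⟨rename .inl r + rename .inr s - C c,
    ⟨(g' - C v, h' - C (v + constantCoeff h' - constantCoeff g')), mem_glued.2 (by simp; ring)⟩,
    Subtype.ext ?_⟩
  rw [map_sub, map_add]
  simp only [Subring.coe_add, Subring.coe_mul, AddSubgroupClass.coe_sub, coe_toGlued_rename_inl,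
    coe_toGlued_rename_inr, coe_toGlued_C, hv, hv']
  ext1
  · simp only [Prod.fst_add, Prod.fst_sub, Prod.fst_mul, C_add, C_mul]
    ring
  · simp only [Prod.snd_add, Prod.snd_sub, Prod.snd_mul, C_add, C_mul]
    ring

theorem toGlued_C_regular [IsDomain V] {f : k →+* V} {w : k} (hw : f w ≠ 0) :
    IsLeftRegular (toGlued f a (C w)) := by
  intro s t h
  have h' := congrArg Subtype.val h
  simp only [Subring.coe_mul, coe_toGlued_C, Prod.ext_iff, Prod.fst_mul, Prod.snd_mul] at h'
  exact Subtype.ext (Prod.ext (mul_left_cancel₀ (by simpa using hw) h'.1)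
    (mul_left_cancel₀ (by simpa using hw) h'.2))

theorem exists_map_eq_pow_mul {F : Type*} [CommRing F] {g : V →+* F} {w : V}
    (hF : ∀ x, ∃ N v, g v = g w ^ N * x) (f : MvPolynomial σ F) :
    ∃ N f', ∀ M, N ≤ M → MvPolynomial.map g (C w ^ (M - N) * f') = C (g w) ^ M * f := by
  suffices ∃ N f', MvPolynomial.map g f' = C (g w) ^ N * f by
    obtain ⟨N, f', h⟩ := this
    refine ⟨N, f', fun M hM ↦ ?_⟩
    rw [map_mul, h, map_pow, map_C, ← mul_assoc, ← pow_add, Nat.sub_add_cancel hM]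
  induction f using MvPolynomial.induction_on with
  | C v =>
    obtain ⟨N, v', h⟩ := hF v
    exact ⟨N, C v', by simp [h]⟩
  | add f₁ f₂ h₁ h₂ =>
    obtain ⟨N₁, g₁, h₁⟩ := h₁
    obtain ⟨N₂, g₂, h₂⟩ := h₂
    refine ⟨N₁ + N₂, C w ^ N₂ * g₁ + C w ^ N₁ * g₂, ?_⟩
    simp only [map_add, map_mul, map_pow, map_C, h₁, h₂]
    ring
  | mul_X f₁ i h₁ =>
    obtain ⟨N₁, g₁, h₁⟩ := h₁
    exact ⟨N₁, g₁ * X i, by rw [map_mul, map_X, h₁, mul_assoc]⟩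

theorem map_translateEval {F : Type*} [CommRing F] (g : V →+* F) (r : MvPolynomial (σ ⊕ τ) k) :
    MvPolynomial.map g (translateEval σ τ f a r) = translateEval σ τ (g.comp f) (g ∘ a) r := by
  rw [← RingHom.comp_apply]
  congr 1
  refine MvPolynomial.ringHom_ext (fun r ↦ by simp) ?_
  rintro (i | j) <;> simp

end Glued

theorem relationsDescend_toGlued {k V F σ τ : Type} [CommRing k] [IsDomain k] [CommRing V]
    [Field F] {g : V →+* F} (hg : Function.Injective g) {f : k →+* V} {a : σ ⊕ τ → V}
    (ha : Function.Injective (eval₂Hom f a)) {w : k}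
    (hF : ∀ x, ∃ N v, g v = g (f w) ^ N * x) : RelationsDescend (toGlued f a) (C w) := by
  intro ι _ r t ht
  have hga : Function.Injective (eval₂Hom (g.comp f) (g ∘ a)) := by
    have : eval₂Hom (g.comp f) (g ∘ a) = g.comp (eval₂Hom f a) :=
      MvPolynomial.ringHom_ext (by simp) (by simp)
    rw [this]
    exact hg.comp ha
  have hinr : Function.Injective (eval₂Hom (g.comp f) fun j : τ ↦ (g ∘ a) (.inr j)) := by
    have h := hga.comp (rename_injective _ (Sum.inr_injective (α := σ) (β := τ)))
    convert h using 1
    ext r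
    simp [eval₂_rename]
    rfl
  have hinl : Function.Injective
      (eval₂Hom (g.comp f) fun j : σ ↦ (g ∘ a ∘ Sum.swap (α := τ)) (.inr j)) := by
    have h := hga.comp (rename_injective _ (Sum.inl_injective (α := σ) (β := τ)))
    convert h using 1
    ext r
    simp [eval₂_rename]
    rfl
  let G : Glued σ τ V →+* MvPolynomial σ F × MvPolynomial τ F :=
    ((MvPolynomial.map g).prodMap (MvPolynomial.map g)).comp (Glued σ τ V).subtype
  have hGinj : Function.Injective G :=
    ((map_injective g hg).prodMap (map_injective g hg)).comp Subtype.val_injective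
  let α₁ := translateEval σ τ (g.comp f) (g ∘ a)
  let α₂ := (translateEval τ σ (g.comp f) (g ∘ a ∘ Sum.swap)).comp (rename Sum.swap).toRingHom
  have hG (r) : G (toGlued f a r) = α₁.prod α₂ r := by
    ext1
    · exact map_translateEval ..
    · exact map_translateEval ..
  have hα₁ : α₁.Flat := translateEval_flat _ _ hinr
  have hα₂ : α₂.Flat := (RingHom.Flat.of_bijective
    (renameEquiv k (Equiv.sumComm σ τ)).bijective).comp (translateEval_flat _ _ hinl)
  have hcomm₁ : constantCoeff.comp α₁ = eval₂Hom (g.comp f) (g ∘ a) :=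
    constantCoeff_comp_translateEval _ _
  have hcomm : constantCoeff.comp α₁ = constantCoeff.comp α₂ := by
    refine RingHom.ext fun r ↦ ?_
    simp only [hcomm₁, RingHom.comp_apply, α₂, constantCoeff_translateEval]
    simp [eval₂_rename, Function.comp_assoc]
  obtain ⟨l, s, y, hy, hs, hfs⟩ := exists_of_flat_fibreProduct hα₁ hα₂
    (hcomm₁ ▸ flat_of_injective_of_field hga) hcomm
    (fun c ↦ ⟨C c, constantCoeff_C _ c⟩) r (fun i ↦ G (t i))
    (fun i ↦ by
      have := (t i).2
      rw [mem_glued] at this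
      simp [G, constantCoeff_map, this])
    (by simpa only [map_sum, map_mul, hG, map_zero] using congrArg G ht)
  choose N₁ y₁ h₁ using fun j ↦ exists_map_eq_pow_mul hF (y j).1
  choose N₂ y₂ h₂ using fun j ↦ exists_map_eq_pow_mul hF (y j).2
  set N := ∑ j, (N₁ j + N₂ j) with hN
  have hle (j) : N₁ j + N₂ j ≤ N :=
    Finset.single_le_sum (f := fun j ↦ N₁ j + N₂ j) (fun _ _ ↦ Nat.zero_le _) (Finset.mem_univ j)
  have e₁ (j) := h₁ j N (by have := hle j; omega)
  have e₂ (j) := h₂ j N (by have := hle j; omega)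
  have hmem (j) : (C (f w) ^ (N - N₁ j) * y₁ j, C (f w) ^ (N - N₂ j) * y₂ j) ∈ Glued σ τ V := by
    refine mem_glued.2 (hg ?_)
    rw [← constantCoeff_map, ← constantCoeff_map, e₁, e₂, map_mul, map_mul, hy]
    simp
  have hGy (j) : G ⟨_, hmem j⟩ = α₁.prod α₂ (C w) ^ N * y j := by
    refine Prod.ext ((e₁ j).trans ?_) ((e₂ j).trans ?_)
    · simp [α₁]
    · simp [α₂]
  refine ⟨N, l, s, fun j ↦ ⟨_, hmem j⟩, fun i ↦ hGinj ?_, hfs⟩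
  simp only [map_mul, map_sum, map_pow, hG, hs, Finset.mul_sum, hGy]
  exact Finset.sum_congr rfl fun j _ ↦ by ring

end NoncatenaryFRegular

namespace NoncatenaryFRegular

section Splittings

/-- An additive endomorphism of `B` which is linear over `q`-th powers. -/
def IsRootLinear {B : Type*} [CommRing B] (q : ℕ) (ψ : B →+ B) : Prop :=
  ∀ t u, ψ (t ^ q * u) = t * ψ u

section PowerSeries

open PowerSeries

variable {p : ℕ} [Fact p.Prime]

/-- Extract the coefficients in degrees congruent to `n` modulo `q`. -/
noncomputable def extractCoeffs (k : Type*) [CommRing k] (q n : ℕ) : k⟦X⟧ →+ k⟦X⟧ where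
  toFun v := PowerSeries.mk fun j ↦ coeff (n + q * j) v
  map_zero' := by ext; simp
  map_add' u v := by ext; simp

@[simp]
theorem coeff_extractCoeffs {k : Type*} [CommRing k] (q n j : ℕ) (v : k⟦X⟧) :
    coeff j (extractCoeffs k q n v) = coeff (n + q * j) v := by
  simp [extractCoeffs]

theorem isRootLinear_extractCoeffs {e n : ℕ} (hn : n < p ^ e) :
    IsRootLinear (p ^ e) (extractCoeffs (ZMod p) (p ^ e) n) := by
  intro u v
  have hq : p ^ e ≠ 0 := pow_ne_zero _ (Fact.out : p.Prime).ne_zero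
  have hu : u ^ p ^ e = expand (p ^ e) hq u := by
    have := MvPowerSeries.map_iterateFrobenius_expand p (Fact.out : p.Prime).ne_zero u e
    have hid : iterateFrobenius (ZMod p) p e = RingHom.id _ := Subsingleton.elim _ _
    rw [hid, MvPowerSeries.map_id] at this
    exact this.symm
  ext j
  rw [hu, coeff_extractCoeffs, coeff_mul, coeff_mul]
  symm
  refine Finset.sum_of_injOn (fun x ↦ (p ^ e * x.1, n + p ^ e * x.2)) ?_ ?_ ?_ ?_
  · rintro ⟨a, b⟩ - ⟨c, d⟩ - h
    simp only [Prod.mk.injEq, Nat.add_left_cancel_iff] at h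
    exact Prod.ext (Nat.eq_of_mul_eq_mul_left (Nat.pos_of_ne_zero hq) h.1) (Nat.eq_of_mul_eq_mul_left (Nat.pos_of_ne_zero hq) h.2)
  · rintro ⟨a, b⟩ h
    simp only [Finset.mem_coe, Finset.HasAntidiagonal.mem_antidiagonal] at h ⊢
    rw [← h]; ring
  · rintro ⟨a, b⟩ h hnot
    rw [Finset.HasAntidiagonal.mem_antidiagonal] at h
    rw [coeff_expand, if_neg, zero_mul]
    rintro ⟨c, rfl⟩
    dsimp only at h
    have hcj : c ≤ j := by
      by_contra! hlt
      have : p ^ e * (j + 1) ≤ p ^ e * c := Nat.mul_le_mul_left _ hlt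
      rw [mul_add] at this
      omega
    obtain ⟨d, rfl⟩ := Nat.exists_eq_add_of_le hcj
    refine hnot ⟨(c, d), by simp, ?_⟩
    rw [mul_add] at h
    simp only [Prod.mk.injEq, true_and]
    omega
  · rintro ⟨a, b⟩ h
    simp

end PowerSeries

section MvPolynomial

open MvPolynomial

variable {B σ τ : Type*} [CommRing B]

theorem coeff_sum_preimage_nsmul {q : ℕ} (hq : q ≠ 0) (ψ : B →+ B) (f : MvPolynomial σ B)
    (m : σ →₀ ℕ) : coeff m (∑ n ∈ f.support.preimage (q • ·) (nsmul_right_injective hq).injOn,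
      monomial n (ψ (coeff (q • n) f))) = ψ (coeff (q • m) f) := by
  classical
  simp only [coeff_sum, coeff_monomial, Finset.sum_ite_eq', Finset.mem_preimage, mem_support_iff]
  split_ifs with h
  · rfl
  · rw [not_not.1 h, map_zero]

/-- Apply `ψ` to the coefficients of the `q`-th power monomials and take `q`-th roots of these. -/
noncomputable def rootPolynomial (σ : Type*) {q : ℕ} (hq : q ≠ 0) (ψ : B →+ B) :
    MvPolynomial σ B →+ MvPolynomial σ B where
  toFun f := ∑ n ∈ f.support.preimage (q • ·) (nsmul_right_injective hq).injOn,
    monomial n (ψ (coeff (q • n) f))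
  map_zero' := by ext; rw [coeff_sum_preimage_nsmul hq]; simp
  map_add' f g := by
    ext
    rw [coeff_add, coeff_sum_preimage_nsmul hq, coeff_sum_preimage_nsmul hq,
      coeff_sum_preimage_nsmul hq, coeff_add, map_add]

theorem coeff_rootPolynomial {q : ℕ} (hq : q ≠ 0) (ψ : B →+ B) (f : MvPolynomial σ B)
    (m : σ →₀ ℕ) : coeff m (rootPolynomial σ hq ψ f) = ψ (coeff (q • m) f) :=
  coeff_sum_preimage_nsmul hq ψ f m

theorem constantCoeff_rootPolynomial {q : ℕ} (hq : q ≠ 0) (ψ : B →+ B) (f : MvPolynomial σ B) :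
    constantCoeff (rootPolynomial σ hq ψ f) = ψ (constantCoeff f) := by
  simpa [constantCoeff_eq] using coeff_rootPolynomial hq ψ f 0

theorem isRootLinear_rootPolynomial {p e : ℕ} [Fact p.Prime] [CharP B p] (hq : p ^ e ≠ 0)
    {ψ : B →+ B} (hψ : IsRootLinear (p ^ e) ψ) :
    IsRootLinear (p ^ e) (rootPolynomial σ hq ψ) := by
  intro t u
  induction t using MvPolynomial.induction_on' with
  | monomial m v =>
    ext n
    rw [coeff_rootPolynomial, monomial_pow, coeff_monomial_mul', coeff_monomial_mul']
    have hle : p ^ e • m ≤ p ^ e • n ↔ m ≤ n := by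
      simp [Finsupp.le_def, Nat.pos_of_ne_zero hq]
    simp only [hle]
    split_ifs with h
    · rw [hψ, coeff_rootPolynomial]
      congr 3
      ext i
      simp [Nat.mul_sub]
    · simp
  | add f g hf hg => rw [add_pow_char_pow, add_mul, map_add, hf, hg, add_mul]

/-- The endomorphism of the glued ring induced by an additive endomorphism of `B`. -/
noncomputable def rootGlued (σ τ : Type*) {q : ℕ} (hq : q ≠ 0) (ψ : B →+ B) :
    Glued σ τ B →+ Glued σ τ B where
  toFun t := ⟨(rootPolynomial σ hq ψ t.1.1, rootPolynomial τ hq ψ t.1.2),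
    mem_glued.2 (by
      rw [constantCoeff_rootPolynomial, constantCoeff_rootPolynomial, mem_glued.1 t.2])⟩
  map_zero' := by ext1; simp
  map_add' s t := by ext1; simp

theorem gluedCoeff_rootGlued {q : ℕ} (hq : q ≠ 0) (ψ : B →+ B) (t : Glued σ τ B) :
    gluedCoeff σ τ B (rootGlued σ τ hq ψ t) = ψ (gluedCoeff σ τ B t) :=
  constantCoeff_rootPolynomial hq ψ _

theorem isRootLinear_rootGlued {p e : ℕ} [Fact p.Prime] [CharP B p] (hq : p ^ e ≠ 0)
    {ψ : B →+ B} (hψ : IsRootLinear (p ^ e) ψ) : IsRootLinear (p ^ e) (rootGlued σ τ hq ψ) :=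
  fun _ _ ↦ Subtype.ext (Prod.ext (isRootLinear_rootPolynomial hq hψ _ _)
    (isRootLinear_rootPolynomial hq hψ _ _))

end MvPolynomial

open PowerSeries in
theorem hasSplittings_gluedCoeff (p : ℕ) [Fact p.Prime] (σ τ : Type*) :
    HasSplittings p (gluedCoeff σ τ (ZMod p)⟦X⟧) := by
  intro c hc
  set n := (gluedCoeff σ τ (ZMod p)⟦X⟧ c).order.toNat with hn
  refine ⟨n, fun e he s hs ↦ ?_⟩
  have hp : p.Prime := Fact.out
  have hq : p ^ e ≠ 0 := pow_ne_zero _ hp.ne_zero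
  have hne : n < p ^ e := he.trans_lt (Nat.lt_pow_self hp.one_lt)
  have : CharP (ZMod p)⟦X⟧ p := charP_of_injective_ringHom PowerSeries.C_injective p
  refine ⟨rootGlued σ τ hq (extractCoeffs (ZMod p) (p ^ e) n),
    isRootLinear_rootGlued hq (isRootLinear_extractCoeffs hne), ?_⟩
  rw [gluedCoeff_rootGlued, map_mul, PowerSeries.isUnit_iff_constantCoeff,
    ← coeff_zero_eq_constantCoeff_apply, coeff_extractCoeffs, isUnit_iff_ne_zero, mul_zero,
    add_zero]
  have : n = (gluedCoeff σ τ (ZMod p)⟦X⟧ s * gluedCoeff σ τ (ZMod p)⟦X⟧ c).order.toNat := by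
    rw [order_mul, order_zero_of_unit hs, zero_add]
  rw [this]
  exact coeff_order (mul_ne_zero hs.ne_zero hc)

end Splittings

end NoncatenaryFRegular

namespace NoncatenaryFRegular

section Localization

variable {R T V : Type} [CommRing R] [CommRing T] [CommRing V] [IsLocalRing V]
  {φ : R →+* T} {ε : T →+* V} {w : R}
  {A : Type} [CommRing A] [Algebra (saturation φ w) A] [IsLocalization.AtPrime A (centre φ ε w)]

variable (φ w A) in
/-- The structure map from `R` to the localization of the saturation. -/
def toLocalization : R →+* A := (algebraMap (saturation φ w) A).comp (toSaturation φ w)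

theorem toLocalization_apply (r : R) :
    toLocalization φ w A r = algebraMap (saturation φ w) A (toSaturation φ w r) := rfl

theorem isDenseAway_toLocalization {A : Type} [CommRing A] [Algebra (saturation φ w) A]
    (ε : T →+* V) [IsLocalization.AtPrime A (centre φ ε w)] :
    IsDenseAway (toLocalization φ w A) w := by
  intro x
  obtain ⟨t, s, rfl⟩ := IsLocalization.exists_mk'_eq (centre φ ε w).primeCompl x
  obtain ⟨N, r, hr⟩ := mem_saturation.1 t.2
  refine ⟨N, (IsLocalization.map_units A s).unit, r, ?_⟩
  rw [IsUnit.unit_spec, IsLocalization.mk'_spec', toLocalization_apply, toLocalization_apply,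
    ← map_pow, ← map_mul]
  exact congrArg _ (Subtype.ext hr)

variable (A) in
theorem exists_prime_mem_iff [IsDomain V] (θ : T →+* V) (hθ : ∀ t, IsUnit (ε t) → IsUnit (θ t)) :
    ∃ q : PrimeSpectrum A,
      ∀ t : saturation φ w, algebraMap (saturation φ w) A t ∈ q.asIdeal ↔ θ t = 0 := by
  let θ' := IsLocalization.lift (M := (centre φ ε w).primeCompl) (S := A)
    (g := θ.comp (saturation φ w).subtype) fun s ↦ hθ _ (mem_centre_primeCompl.1 s.2)
  refine ⟨⟨RingHom.ker θ', RingHom.ker_isPrime θ'⟩, fun t ↦ ?_⟩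
  rw [RingHom.mem_ker, IsLocalization.lift_eq]
  rfl

theorem IsDescentDatum.maximalIdeal_eq_sup [IsLocalRing A] (h : IsDescentDatum φ ε w) {q : Ideal A}
    (hq : q ≠ ⊤) (hr : ∀ r, ε (φ r) ∈ maximalIdeal V →
      toLocalization φ w A r ∈ q ⊔ Ideal.span {toLocalization φ w A w}) :
    maximalIdeal A = q ⊔ Ideal.span {toLocalization φ w A w} := by
  refine le_antisymm (fun x hx ↦ ?_) (sup_le (le_maximalIdeal hq) ?_)
  · obtain ⟨t, s, rfl⟩ := IsLocalization.exists_mk'_eq (centre φ ε w).primeCompl x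
    rw [IsLocalization.AtPrime.mk'_mem_maximal_iff _ (centre φ ε w)] at hx
    obtain ⟨r, t', ht⟩ := h.surj t
    have ht' : t' ∈ saturation φ w := mem_saturation_of_pow_mul_mem (N := 1) (by
      rw [pow_one, eq_sub_of_add_eq' ht.symm]
      exact sub_mem t.2 (map_mem_saturation φ w r))
    have htr : t = toSaturation φ w r + toSaturation φ w w * ⟨t', ht'⟩ := Subtype.ext ht
    have hr' : ε (φ r) ∈ maximalIdeal V := by
      have hx : ε t ∈ maximalIdeal V := hx
      rw [ht, map_add, map_mul] at hx
      exact (Ideal.add_mem_iff_left _ (Ideal.mul_mem_right _ _ h.mem)).1 hx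
    refine (Ideal.unit_mul_mem_iff_mem _ (IsLocalization.map_units A s)).1 ?_
    rw [IsLocalization.mk'_spec', htr, map_add, map_mul]
    exact add_mem (hr r hr') (Ideal.mem_sup_right
      (Ideal.mul_mem_right _ _ (Ideal.mem_span_singleton_self _)))
  · rw [Ideal.span_singleton_le_iff_mem, toLocalization_apply,
      IsLocalization.AtPrime.to_map_mem_maximal_iff _ (centre φ ε w)]
    exact h.mem

end Localization

open MvPolynomial

section Evaluation

variable {k V ι : Type*} [CommRing k] [CommRing V]

theorem sub_aeval_mem_span_X (s : Set ι) [DecidablePred (· ∈ s)] (r : MvPolynomial ι k) :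
    r - aeval (fun i ↦ if i ∈ s then 0 else X i : ι → MvPolynomial ι k) r ∈
      Ideal.span (X '' s) := by
  rw [← Ideal.Quotient.eq]
  change Ideal.Quotient.mkₐ k _ r = ((Ideal.Quotient.mkₐ k _).comp (aeval _)) r
  congr 1
  refine MvPolynomial.algHom_ext fun i ↦ ?_
  rw [AlgHom.comp_apply, aeval_X]
  split_ifs with hi
  · rw [map_zero, Ideal.Quotient.mkₐ_eq_mk, Ideal.Quotient.eq_zero_iff_mem]
    exact Ideal.subset_span ⟨i, hi, rfl⟩
  · rfl

theorem ker_eval₂Hom_ite {f : k →+* V} {a : ι → V} (ha : Function.Injective (eval₂Hom f a))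
    (s : Set ι) [DecidablePred (· ∈ s)] :
    RingHom.ker (eval₂Hom f fun i ↦ if i ∈ s then 0 else a i) = Ideal.span (X '' s) := by
  refine le_antisymm (fun r hr ↦ ?_) (Ideal.span_le.2 ?_)
  · have h0 : aeval (fun i ↦ if i ∈ s then 0 else X i : ι → MvPolynomial ι k) r = 0 := by
      refine (injective_iff_map_eq_zero _).1 ha _ ?_
      rw [← RingHom.mem_ker.1 hr]
      change ((eval₂Hom f a).comp (aeval _ : _ →ₐ[k] MvPolynomial ι k).toRingHom) r = _
      congr 1
      refine MvPolynomial.ringHom_ext (fun c ↦ by simp) fun i ↦ ?_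
      by_cases hi : i ∈ s <;> simp [hi]
    have := sub_aeval_mem_span_X s r
    rwa [h0, sub_zero] at this
  · rintro _ ⟨i, hi, rfl⟩
    simp [hi]

theorem isUnit_eval_of_isUnit_constantCoeff [IsLocalRing V] {b : ι → V}
    (hb : ∀ i, b i ∈ maximalIdeal V) {g : MvPolynomial ι V} (hg : IsUnit (constantCoeff g)) :
    IsUnit (eval b g) := by
  have : residue V (eval b g) = residue V (constantCoeff g) := by
    change ((residue V).comp (eval b)) g = ((residue V).comp constantCoeff) g
    congr 1
    exact MvPolynomial.ringHom_ext (fun c ↦ by simp) fun i ↦ by simpa using hb i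
  rw [← residue_ne_zero_iff_isUnit] at hg ⊢
  rwa [this]

theorem map_mem_of_eval₂_mem [IsLocalRing V] {f : k →+* V} {a : ι → V}
    (ha : ∀ i, a i ∈ maximalIdeal V) {w : k} (hk : ∀ c, f c ∈ maximalIdeal V → w ∣ c)
    {A : Type*} [CommRing A] (ψ : MvPolynomial ι k →+* A) {J : Ideal A} (hw : ψ (C w) ∈ J)
    (hX : ∀ i, ψ (X i) ∈ J) {r : MvPolynomial ι k} (hr : eval₂Hom f a r ∈ maximalIdeal V) :
    ψ r ∈ J := by
  have h1 : residue V (eval₂Hom f a r) = residue V (f (constantCoeff r)) := by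
    change ((residue V).comp (eval₂Hom f a)) r = (((residue V).comp f).comp constantCoeff) r
    congr 1
    exact MvPolynomial.ringHom_ext (fun c ↦ by simp) fun i ↦ by simpa using ha i
  have h2 : Ideal.Quotient.mk J (ψ r) = Ideal.Quotient.mk J (ψ (C (constantCoeff r))) := by
    change ((Ideal.Quotient.mk J).comp ψ) r =
      ((((Ideal.Quotient.mk J).comp ψ).comp C).comp constantCoeff) r
    congr 1
    exact MvPolynomial.ringHom_ext (fun c ↦ by simp) fun i ↦ by
      simpa [Ideal.Quotient.eq_zero_iff_mem] using hX i
  rw [(residue_eq_zero_iff _).2 hr, eq_comm, residue_eq_zero_iff] at h1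
  obtain ⟨c, hc⟩ := hk _ h1
  rw [← Ideal.Quotient.eq_zero_iff_mem, h2, Ideal.Quotient.eq_zero_iff_mem, hc, map_mul, map_mul]
  exact Ideal.mul_mem_right _ _ hw

end Evaluation

section Chains

variable {k V σ τ : Type} [CommRing k] [CommRing V] [IsDomain V] [IsLocalRing V]
  {f : k →+* V} {a : σ ⊕ τ → V} {w : k}
  {A : Type} [CommRing A] [Algebra (saturation (toGlued f a) (C w)) A]
  [IsLocalization.AtPrime A (centre (toGlued f a) (gluedCoeff σ τ V) (C w))]

theorem exists_prime_comap_eq_of_ringHom (ha : Function.Injective (eval₂Hom f a))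
    (hw : f w ≠ 0) (s : Set (σ ⊕ τ)) [DecidablePred (· ∈ s)] (θ : Glued σ τ V →+* V)
    (hunit : ∀ t, IsUnit (gluedCoeff σ τ V t) → IsUnit (θ t))
    (hθ : θ.comp (toGlued f a) = eval₂Hom f fun i ↦ if i ∈ s then 0 else a i) :
    ∃ q : PrimeSpectrum A, toLocalization (toGlued f a) (C w) A (C w) ∉ q.asIdeal ∧
      q.asIdeal.comap (toLocalization (toGlued f a) (C w) A) = Ideal.span (X '' s) := by
  obtain ⟨q, hq⟩ := exists_prime_mem_iff (φ := toGlued f a) (w := C w) A θ hunit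
  have hmem (r : MvPolynomial (σ ⊕ τ) k) : toLocalization (toGlued f a) (C w) A r ∈ q.asIdeal ↔
      eval₂Hom f (fun i ↦ if i ∈ s then 0 else a i) r = 0 := by
    rw [toLocalization_apply, hq, ← hθ]
    rfl
  refine ⟨q, by simpa [hmem] using hw, ?_⟩
  rw [← ker_eval₂Hom_ite ha]
  ext r
  exact hmem r

theorem exists_prime_comap_eq_inl (ha : Function.Injective (eval₂Hom f a))
    (ham : ∀ i, a i ∈ maximalIdeal V) (hw : f w ≠ 0) (s : Set σ) :
    ∃ q : PrimeSpectrum A, toLocalization (toGlued f a) (C w) A (C w) ∉ q.asIdeal ∧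
      q.asIdeal.comap (toLocalization (toGlued f a) (C w) A) =
        Ideal.span (X '' (Sum.inl '' s)) := by
  classical
  refine exists_prime_comap_eq_of_ringHom ha hw _
    ((eval fun i ↦ if i ∈ s then -a (.inl i) else 0).comp
      ((RingHom.fst _ _).comp (Glued σ τ V).subtype)) (fun t ht ↦ ?_) ?_
  · refine isUnit_eval_of_isUnit_constantCoeff (fun i ↦ ?_) ht
    split_ifs
    exacts [neg_mem (ham _), zero_mem _]
  · refine MvPolynomial.ringHom_ext (fun c ↦ by simp [toGlued_fst]) ?_
    rintro (i | j)
    · by_cases hi : i ∈ s <;> simp [toGlued_fst, hi]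
    · simp [toGlued_fst]

theorem exists_prime_comap_eq_inr (ha : Function.Injective (eval₂Hom f a))
    (ham : ∀ i, a i ∈ maximalIdeal V) (hw : f w ≠ 0) (s : Set τ) :
    ∃ q : PrimeSpectrum A, toLocalization (toGlued f a) (C w) A (C w) ∉ q.asIdeal ∧
      q.asIdeal.comap (toLocalization (toGlued f a) (C w) A) =
        Ideal.span (X '' (Sum.inr '' s)) := by
  classical
  refine exists_prime_comap_eq_of_ringHom ha hw _
    ((eval fun i ↦ if i ∈ s then -a (.inr i) else 0).comp
      ((RingHom.snd _ _).comp (Glued σ τ V).subtype)) (fun t ht ↦ ?_) ?_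
  · rw [gluedCoeff_apply'] at ht
    refine isUnit_eval_of_isUnit_constantCoeff (fun i ↦ ?_) ht
    split_ifs
    exacts [neg_mem (ham _), zero_mem _]
  · refine MvPolynomial.ringHom_ext (fun c ↦ by simp [toGlued_snd]) ?_
    rintro (i | j)
    · simp [toGlued_snd]
    · by_cases hj : j ∈ s <;> simp [toGlued_snd, hj]

theorem exists_toLocalization_X_mul_X {R V σ τ : Type} [CommRing R] [CommRing V] {f : R →+* V}
    {a : σ ⊕ τ → V} {w : R} {A : Type} [CommRing A]
    [Algebra (saturation (toGlued f a) (C w)) A] {u : σ ⊕ τ → V} (hau : ∀ i, a i = f w + f w ^ 2 * u i)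
    (i : σ) (j : τ) : ∃ x : A, toLocalization (toGlued f a) (C w) A (X (.inl i)) *
        toLocalization (toGlued f a) (C w) A (X (.inr j)) =
      toLocalization (toGlued f a) (C w) A (C w) *
        (toLocalization (toGlued f a) (C w) A (X (.inl i)) +
          toLocalization (toGlued f a) (C w) A (X (.inr j)) +
          toLocalization (toGlued f a) (C w) A (C w) * x) := by
  let t : Glued σ τ V :=
    ⟨(C (u (.inr j)) * (X i + C (a (.inl i))) - C (1 + f w * u (.inr j)),
      C (u (.inl i)) * (X j + C (a (.inr j))) - C (1 + f w * u (.inl i))), by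
      simp only [mem_glued, hau, map_sub, map_mul, map_add, constantCoeff_X, constantCoeff_C]
      ring⟩
  have ht : toGlued f a (X (.inl i)) * toGlued f a (X (.inr j)) = toGlued f a (C w) *
      (toGlued f a (X (.inl i)) + toGlued f a (X (.inr j)) + toGlued f a (C w) * t) := by
    refine Subtype.ext (Prod.ext ?_ ?_)
    · simp only [Subring.coe_mul, Subring.coe_add, Prod.fst_mul, Prod.fst_add, toGlued_fst, t,
        translateEval_C, translateEval_X_inl, translateEval_X_inr, hau, map_add, map_mul, map_pow,
        map_one]
      ring
    · simp only [Subring.coe_mul, Subring.coe_add, Prod.snd_mul, Prod.snd_add, toGlued_snd, t,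
        rename_C, rename_X, Sum.swap_inl, Sum.swap_inr, Function.comp_apply,
        translateEval_C, translateEval_X_inl, translateEval_X_inr, hau, map_add, map_mul, map_pow,
        map_one]
      ring
  have htm : t ∈ saturation (toGlued f a) (C w) := by
    refine ⟨2, X (.inl i) * X (.inr j) - C w * (X (.inl i) + X (.inr j)), ?_⟩
    rw [map_sub, map_mul, ht, map_mul, map_add]
    ring
  refine ⟨algebraMap (saturation (toGlued f a) (C w)) A ⟨t, htm⟩, ?_⟩
  simp only [toLocalization_apply, ← map_mul, ← map_add]
  exact congrArg _ (Subtype.ext (by simpa using ht))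

end Chains

end NoncatenaryFRegular

namespace NoncatenaryFRegular

open MvPolynomial

section Catenary

theorem height_span_X_le {k ι : Type*} [CommRing k] [IsDomain k] [IsNoetherianRing k] [Finite ι]
    (s : Finset ι) (hs : (Ideal.span (X '' (s : Set ι)) : Ideal (MvPolynomial ι k)).IsPrime) :
    (Ideal.span (X '' (s : Set ι)) : Ideal (MvPolynomial ι k)).height ≤ s.card := by
  classical
  rw [← Finset.coe_image]
  rw [← Finset.coe_image] at hs
  have hmin : Ideal.span ((s.image X : Finset (MvPolynomial ι k)) : Set (MvPolynomial ι k)) ∈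
      (Ideal.span ((s.image X : Finset (MvPolynomial ι k)) : Set _)).minimalPrimes := by
    rw [Ideal.minimalPrimes_eq_subsingleton_self]
    rfl
  exact (Ideal.height_le_card_of_mem_minimalPrimes_span_finset hmin).trans
    (Nat.cast_le.2 Finset.card_image_le)

variable {k V : Type} [CommRing k] [IsDomain k] [IsNoetherianRing k] [CommRing V] [IsDomain V]
  [IsLocalRing V] {f : k →+* V} {a u : Fin 2 ⊕ Unit → V} {w : k}
  {A : Type} [CommRing A] [Algebra (saturation (toGlued f a) (C w)) A]
  [IsLocalization.AtPrime A (centre (toGlued f a) (gluedCoeff (Fin 2) Unit V) (C w))]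

theorem not_isCatenaryRing [IsLocalRing A] [IsNoetherianRing A] [IsDomain A]
    (h : IsDescentDatum (toGlued f a) (gluedCoeff (Fin 2) Unit V) (C w))
    (hau : ∀ i, a i = f w + f w ^ 2 * u i) (hw : f w ≠ 0)
    (hk : ∀ c, f c ∈ maximalIdeal V → w ∣ c) : ¬ IsCatenaryRing A := by
  have ha : Function.Injective (eval₂Hom f a) := gluedCoeff_comp_toGlued f a ▸ h.inj
  have hwm : f w ∈ maximalIdeal V := by
    have := h.mem
    rwa [gluedCoeff_toGlued, coe_eval₂Hom, eval₂_C] at this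
  have ham (i) : a i ∈ maximalIdeal V := by
    rw [hau, pow_two, mul_assoc]
    exact add_mem hwm (Ideal.mul_mem_right _ _ hwm)
  set ψ := toLocalization (toGlued f a) (C w) A with hψ
  have hdense : IsDenseAway ψ (C w) := isDenseAway_toLocalization (gluedCoeff (Fin 2) Unit V)
  have hψinj : Function.Injective ψ := by
    refine h.algebraMap_injective.comp fun r r' hr ↦ h.inj ?_
    exact congrArg (gluedCoeff (Fin 2) Unit V) (congrArg Subtype.val hr)
  let o : PrimeSpectrum A := ⟨⊥, Ideal.isPrime_bot⟩
  have hcov {q : PrimeSpectrum A} (hq : ψ (C w) ∉ q.asIdeal)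
      (hX : ∀ i, ψ (X i) ∈ q.asIdeal ⊔ Ideal.span {ψ (C w)}) : q ⋖ closedPoint A := by
    refine covBy_closedPoint hq (h.maximalIdeal_eq_sup q.2.ne_top fun r hr ↦ ?_)
    rw [gluedCoeff_toGlued] at hr
    exact map_mem_of_eval₂_mem ham hk ψ
      (Ideal.mem_sup_right (Ideal.mem_span_singleton_self _)) hX hr
  have hsum {q : PrimeSpectrum A} (hq : ψ (C w) ∉ q.asIdeal) (i : Fin 2)
      (hX : ψ (X (.inl i)) ∈ q.asIdeal ∨ ψ (X (.inr ())) ∈ q.asIdeal) :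
      ψ (X (.inl i)) + ψ (X (.inr ())) ∈ q.asIdeal ⊔ Ideal.span {ψ (C w)} := by
    obtain ⟨x, hx⟩ := exists_toLocalization_X_mul_X (A := A) hau i ()
    have hmem : ψ (X (.inl i)) * ψ (X (.inr ())) ∈ q.asIdeal :=
      hX.elim (Ideal.mul_mem_right _ _) (Ideal.mul_mem_left _ _)
    rw [hψ, hx] at hmem
    exact (Ideal.add_mem_iff_left _ (Ideal.mem_sup_right
      (Ideal.mul_mem_right _ _ (Ideal.mem_span_singleton_self _)))).1
      (Ideal.mem_sup_left ((q.2.mem_or_mem hmem).resolve_left hq))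
  have hheight {q : PrimeSpectrum A} {s : Finset (Fin 2 ⊕ Unit)}
      (hq : q.asIdeal.comap ψ = Ideal.span (X '' s)) : (q.asIdeal.comap ψ).height ≤ s.card := by
    rw [hq]
    exact height_span_X_le s (hq ▸ inferInstance)
  have hmem {q : PrimeSpectrum A} {s : Set (Fin 2 ⊕ Unit)}
      (hq : q.asIdeal.comap ψ = Ideal.span (X '' s)) {i} (hi : i ∈ s) : ψ (X i) ∈ q.asIdeal := by
    rw [← Ideal.mem_comap, hq]
    exact Ideal.subset_span ⟨i, hi, rfl⟩
  have hpos {q : PrimeSpectrum A} {i} (hi : ψ (X i) ∈ q.asIdeal) : o < q := by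
    refine lt_of_le_of_ne (bot_le (a := q.asIdeal)) ?_
    rintro rfl
    exact X_ne_zero i ((injective_iff_map_eq_zero ψ).1 hψinj _ hi)
  obtain ⟨b, hbw, hb⟩ := exists_prime_comap_eq_inr (A := A) ha ham hw {()}
  obtain ⟨c, hcw, hc⟩ := exists_prime_comap_eq_inl (A := A) ha ham hw {0}
  obtain ⟨d, hdw, hd⟩ := exists_prime_comap_eq_inl (A := A) ha ham hw Set.univ
  have hbX : ψ (X (.inr ())) ∈ b.asIdeal := hmem hb (by simp)
  have hcX : ψ (X (.inl 0)) ∈ c.asIdeal := hmem hc (by simp)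
  have hdX (i : Fin 2) : ψ (X (.inl i)) ∈ d.asIdeal := hmem hd (by simp)
  have hcd : c < d := by
    refine lt_of_le_not_ge (hdense.le_of_comap_le hdw ?_) fun hle ↦ ?_
    · rw [hc, hd]
      exact Ideal.span_mono (Set.image_mono (Set.image_mono (Set.subset_univ _)))
    · have h1 : X (.inl 1) ∈ c.asIdeal.comap ψ := hle (hdX 1)
      rw [hc, mem_ideal_span_X_image] at h1
      simpa using h1 (Finsupp.single (.inl 1) 1)
  refine not_isCatenaryRing_of_covBy (a := o) (b := b) (c := c) (d := d) (e := closedPoint A)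
    (hdense.covBy_of_height hbw (hpos hbX) 0 (by simp) ?_) (hcov hbw ?_)
    (hdense.covBy_of_height hcw (hpos hcX) 0 (by simp) ?_)
    (hdense.covBy_of_height hdw hcd 1 ?_ ?_) (hcov hdw ?_)
  · simpa using hheight (s := {.inr ()}) (by simpa using hb)
  · have hX := Ideal.mem_sup_left (T := Ideal.span {ψ (C w)}) hbX
    rintro (i | i)
    · exact (Ideal.add_mem_iff_left _ hX).1 (hsum hbw i (.inr hbX))
    · exact hX
  · simpa using hheight (s := {.inl 0}) (by simpa using hc)
  · refine le_trans ?_ (Ideal.height_add_one_le_of_lt_of_isPrime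
      (hdense.comap_lt_comap (fun hmem ↦ hcw ((hpos hcX).le hmem)) (hpos hcX)))
    simp
  · refine (hheight (s := {.inl 0, .inl 1}) ?_).trans (Nat.cast_le.2 Finset.card_le_two)
    rw [hd]
    congr 2
    ext (i | i)
    · fin_cases i <;> simp
    · simp
  · have hX (i) := Ideal.mem_sup_left (T := Ideal.span {ψ (C w)}) (hdX i)
    rintro (i | i)
    · exact hX i
    · exact (Ideal.add_mem_iff_right _ (hX 0)).1 (hsum hdw 0 (.inl (hdX 0)))

end Catenary

end NoncatenaryFRegular

namespace NoncatenaryFRegular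

section PowerSeriesRing

theorem exists_algebraicIndependent_mem {R A : Type*} [CommRing R] [CommRing A] [IsDomain A]
    [Countable R] [Algebra R A] (hRA : Function.Injective (algebraMap R A)) {t : Set A}
    (ht : ¬ t.Countable) (ι : Type*) [Countable ι] :
    ∃ a : ι → A, (∀ i, a i ∈ t) ∧ AlgebraicIndependent R a := by
  obtain ⟨u, -, ⟨hu, hut⟩, hmax⟩ := exists_maximal_algebraicIndependent (R := R) ∅ t
    (Set.empty_subset t) ((algebraicIndependent_empty_iff R A).2 hRA)
  have hinf : u.Infinite := by
    intro hfin
    have := hfin.to_subtype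
    have : Countable (Algebra.adjoin R u) := by
      have : Countable (MvPolynomial u R) :=
        Cardinal.mk_le_aleph0_iff.1 (MvPolynomial.cardinalMk_le_max_lift.trans (by simp))
      rw [Algebra.adjoin_eq_range]
      exact (Set.countable_range (MvPolynomial.aeval ((↑) : u → A))).to_subtype
    obtain ⟨x, hxt, hx⟩ := Set.not_subset.1 fun hsub ↦
      ht ((Algebraic.countable (Algebra.adjoin R u) A).mono hsub)
    refine hx (isAlgebraic_algebraMap (⟨x, Algebra.subset_adjoin ?_⟩ : Algebra.adjoin R u))
    exact hmax ⟨hu.insert (by rwa [Set.image_id]), Set.insert_subset hxt hut⟩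
      (Set.subset_insert x u) (Set.mem_insert x u)
  have := hinf.to_subtype
  obtain ⟨e, he⟩ := exists_injective_nat ι
  exact ⟨fun i ↦ Infinite.natEmbedding u (e i), fun i ↦ hut (Subtype.coe_prop _),
    hu.comp _ ((Infinite.natEmbedding u).injective.comp he)⟩

variable (k : Type*) [Field k]

open PowerSeries

theorem uncountable_powerSeries : Uncountable k⟦X⟧ := by
  classical
  have : Uncountable (Set ℕ) := by
    rw [uncountable_iff_forall_not_surjective]
    exact Function.cantor_surjective
  refine Function.Injective.uncountable
    (f := fun s : Set ℕ ↦ (PowerSeries.mk fun n ↦ if n ∈ s then (1 : k) else 0)) fun s t h ↦ ?_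
  ext n
  have hn : (if n ∈ s then (1 : k) else 0) = if n ∈ t then 1 else 0 := by
    simpa using congrArg (coeff n) h
  by_cases h1 : n ∈ s <;> by_cases h2 : n ∈ t <;> simp_all

theorem algebraMap_polynomial_X : algebraMap (Polynomial k) k⟦X⟧ Polynomial.X = X := by
  simp [algebraMap_apply']

theorem exists_eq_coe_add_X_mul (v : k⟦X⟧) :
    ∃ (r : Polynomial k) (v' : k⟦X⟧), v = algebraMap (Polynomial k) k⟦X⟧ r +
      algebraMap (Polynomial k) k⟦X⟧ Polynomial.X * v' := by
  refine ⟨Polynomial.C (constantCoeff v), PowerSeries.mk fun n ↦ coeff (n + 1) v, ?_⟩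
  simpa [algebraMap_apply', add_comm] using eq_X_mul_shift_add_const v

theorem X_dvd_of_coe_mem_maximalIdeal (c : Polynomial k)
    (hc : algebraMap (Polynomial k) k⟦X⟧ c ∈ maximalIdeal k⟦X⟧) : Polynomial.X ∣ c := by
  rw [maximalIdeal_eq_span_X, Ideal.mem_span_singleton, X_dvd_iff] at hc
  rw [Polynomial.X_dvd_iff]
  simpa [algebraMap_apply'] using hc

theorem exists_algebraMap_eq_X_pow_mul (x : LaurentSeries k) :
    ∃ (N : ℕ) (v : k⟦X⟧), algebraMap k⟦X⟧ (LaurentSeries k) v =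
      algebraMap k⟦X⟧ (LaurentSeries k) X ^ N * x := by
  obtain ⟨⟨v, ⟨_, N, rfl⟩⟩, h⟩ :=
    IsLocalization.surj (Submonoid.powers (PowerSeries.X : k⟦X⟧)) x
  exact ⟨N, v, by rw [← h, mul_comm, map_pow]⟩

theorem isDescentDatum_powerSeries {k : Type} [Field k] {σ τ : Type} {a : σ ⊕ τ → k⟦X⟧}
    (ha : AlgebraicIndependent (Polynomial k) a) :
    IsDescentDatum (toGlued (algebraMap (Polynomial k) k⟦X⟧) a) (gluedCoeff σ τ k⟦X⟧)
      (MvPolynomial.C Polynomial.X) where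
  regular := toGlued_C_regular a (by simp [algebraMap_polynomial_X, X_ne_zero])
  surj := exists_eq_toGlued_add_mul a (exists_eq_coe_add_X_mul k)
  rel := relationsDescend_toGlued (F := LaurentSeries k)
    (IsFractionRing.injective k⟦X⟧ (LaurentSeries k)) ha
    (by simpa only [algebraMap_polynomial_X] using exists_algebraMap_eq_X_pow_mul k)
  inj := by
    rw [gluedCoeff_comp_toGlued]
    exact ha
  mem := by
    rw [gluedCoeff_toGlued, MvPolynomial.eval₂Hom_C, algebraMap_polynomial_X,
      maximalIdeal_eq_span_X]
    exact Ideal.mem_span_singleton_self _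

theorem exists_algebraicIndependent_X_add {k : Type*} [Field k] [Countable k] (ι : Type*)
    [Countable ι] : ∃ a u : ι → k⟦X⟧, (∀ i, a i = X + X ^ 2 * u i) ∧
      AlgebraicIndependent (Polynomial k) a := by
  have := uncountable_powerSeries k
  have hinj : Function.Injective fun u : k⟦X⟧ ↦ X + X ^ 2 * u := fun u v h ↦
    mul_left_cancel₀ (pow_ne_zero 2 X_ne_zero) (add_left_cancel h)
  have : Countable (Polynomial k) :=
    Cardinal.mk_le_aleph0_iff.1 (Polynomial.cardinalMk_le_max.trans (by simp))
  have hinj' : Function.Injective (algebraMap (Polynomial k) k⟦X⟧) := by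
    intro r s h
    exact Polynomial.coe_injective k (by simpa [algebraMap_apply'] using h)
  obtain ⟨a, ha, hai⟩ := exists_algebraicIndependent_mem hinj'
    (t := Set.range fun u : k⟦X⟧ ↦ X + X ^ 2 * u)
    (fun h ↦ not_countable (α := k⟦X⟧) (Set.countable_univ_iff.1
      (Set.countable_of_injective_of_countable_image hinj.injOn (by rwa [Set.image_univ])))) ι
  choose u hu using ha
  exact ⟨a, u, fun i ↦ (hu i).symm, hai⟩

theorem localization_weaklyFRegular_not_isCatenaryRing {p : ℕ} [Fact p.Prime]
    {a u : Fin 2 ⊕ Unit → (ZMod p)⟦X⟧} (hau : ∀ i, a i = X + X ^ 2 * u i)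
    (ha : AlgebraicIndependent (Polynomial (ZMod p)) a)
    {A : Type} [CommRing A]
    [Algebra (saturation (toGlued (algebraMap (Polynomial (ZMod p)) (ZMod p)⟦X⟧) a)
      (MvPolynomial.C Polynomial.X)) A]
    [IsLocalization.AtPrime A (centre (toGlued (algebraMap (Polynomial (ZMod p)) (ZMod p)⟦X⟧) a)
      (gluedCoeff (Fin 2) Unit (ZMod p)⟦X⟧) (MvPolynomial.C Polynomial.X))] :
    CharP A p ∧ IsNoetherianRing A ∧ IsLocalRing A ∧ IsDomain A ∧ WeaklyFRegular A p ∧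
      ¬ IsCatenaryRing A := by
  have h := isDescentDatum_powerSeries ha
  have : IsLocalRing A := IsLocalization.AtPrime.isLocalRing A
    (centre (toGlued (algebraMap (Polynomial (ZMod p)) (ZMod p)⟦X⟧) a)
      (gluedCoeff (Fin 2) Unit (ZMod p)⟦X⟧) (MvPolynomial.C Polynomial.X))
  have : IsDomain A := h.isDomain
  have : IsNoetherianRing A := h.isNoetherianRing
  have : CharP (ZMod p)⟦X⟧ p := charP_of_injective_ringHom PowerSeries.C_injective p
  have := RingHom.charP _ h.injective_saturation p
  have : CharP A p := charP_of_injective_ringHom (h.algebraMap_injective (A := A)) p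
  refine ⟨‹_›, ‹_›, ‹_›, ‹_›, h.weaklyFRegular (hasSplittings_gluedCoeff p (Fin 2) Unit),
    not_isCatenaryRing h (u := u) ?_ ?_ (X_dvd_of_coe_mem_maximalIdeal (ZMod p))⟩
  · simpa only [algebraMap_polynomial_X] using hau
  · simpa only [algebraMap_polynomial_X] using X_ne_zero

end PowerSeriesRing

end NoncatenaryFRegular

open NoncatenaryFRegular in
/-- There exists a local domain of prime characteristic which is
weakly F-regular (hence a splinter) but not catenary. -/
theorem exists_weaklyFRegular_local_domain_not_catenary :
    ∃ (A : Type) (_ : CommRing A) (p : ℕ), p.Prime ∧ CharP A p ∧ IsNoetherianRing A ∧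
      IsLocalRing A ∧ IsDomain A ∧ WeaklyFRegular A p ∧ ¬ IsCatenaryRing A := by
  have : Fact (Nat.Prime 2) := ⟨Nat.prime_two⟩
  obtain ⟨a, u, hau, ha⟩ := exists_algebraicIndependent_X_add (k := ZMod 2) (Fin 2 ⊕ Unit)
  exact ⟨Localization.AtPrime (centre (toGlued (algebraMap (Polynomial (ZMod 2)) _) a)
    (gluedCoeff (Fin 2) Unit (PowerSeries (ZMod 2))) (MvPolynomial.C Polynomial.X)),
    inferInstance, 2, Nat.prime_two, localization_weaklyFRegular_not_isCatenaryRing hau ha⟩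
end

section
/- Let (T,m,k) be a complete local reduced ring of prime characteristic p > 0 with dim T ≥ 2 (hence approximately Gorenstein). Suppose {I_s} is an approximately Gorenstein sequence of ideals of T and y_s ∈ T generates the socle of T/I_s for each s. Assume: (1) y_s^{p^e} ∉ I_s^{[p^e]} for all s and all e; (2) there exists a nonmaximal prime ideal p of T such that M_{I_s,y_s} ⊆ p for all s. Then there exists a weakly F-regular local domain (A, m∩A) with (m∩A)-adic completion isomorphic to T. Moreover, given countably many regular elements v_1, v_2, … ∈ m \ p, the ring A may be chosen to contain a T-associate (unit multiple in T) of each v_i. -/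
open IsLocalRing

theorem Ideal.mul_mem_of_covBy {B : Type*} [CommRing B] [IsLocalRing B] {J J' : Ideal B}
    (h : J ⋖ J') {b x : B} (hb : b ∈ maximalIdeal B) (hx : x ∈ J') : b * x ∈ J := by
  by_contra hbx
  have hlt : J < J ⊔ Ideal.span {b * x} :=
    left_lt_sup.2 fun hle => hbx (hle (Ideal.mem_span_singleton_self _))
  have hle : J ⊔ Ideal.span {b * x} ≤ J' :=
    sup_le h.le ((Ideal.span_singleton_le_iff_mem _).2 (J'.mul_mem_left b hx))
  have heq : J ⊔ Ideal.span {b * x} = J' := hle.eq_of_not_lt fun h' => h.2 hlt h'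
  rw [← heq] at hx
  obtain ⟨j, hj, z, hz, hjz⟩ := Submodule.mem_sup.1 hx
  obtain ⟨c, rfl⟩ := Ideal.mem_span_singleton'.1 hz
  have hu : IsUnit (1 - c * b) := by
    by_contra hn
    have h1 : (1 : B) ∈ maximalIdeal B := by
      simpa using add_mem ((mem_maximalIdeal _).2 hn) ((maximalIdeal B).mul_mem_left c hb)
    exact (Ideal.ne_top_iff_one _).1 (maximalIdeal.isMaximal B).ne_top h1
  have : (1 - c * b) * x ∈ J := by
    have : (1 - c * b) * x = j := by linear_combination -hjz
    rwa [this]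
  exact hbx (J.mul_mem_left b ((Ideal.unit_mul_mem_iff_mem J hu).1 this))

section Duality

variable {B : Type*} [CommRing B] [IsLocalRing B] {y : B}

theorem isAtom_span_singleton_of_socle (hy0 : y ≠ 0) (hym : ∀ b ∈ maximalIdeal B, b * y = 0) :
    IsAtom (Ideal.span {y}) := by
  refine ⟨by simpa using hy0, fun N hN => ?_⟩
  by_contra hN0
  obtain ⟨z, hz, hz0⟩ := Submodule.exists_mem_ne_zero_of_ne_bot hN0
  obtain ⟨a, rfl⟩ := Ideal.mem_span_singleton'.1 (hN.le hz)
  have ha : IsUnit a := by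
    by_contra hn
    exact hz0 (hym a hn)
  exact hN.not_ge ((Ideal.span_singleton_le_iff_mem _).2 ((Ideal.unit_mul_mem_iff_mem N ha).1 hz))

/-- The annihilator of `J` grows by length at most one when `J` shrinks by one step. -/
theorem length_annihilator_le_of_covBy (hy0 : y ≠ 0) (hym : ∀ b ∈ maximalIdeal B, b * y = 0)
    (hsoc : ∀ z : B, (∀ b ∈ maximalIdeal B, b * z = 0) → z ∈ Ideal.span {y})
    {J J' : Ideal B} (h : J ⋖ J') :
    Module.length B J.annihilator ≤ Module.length B J'.annihilator + 1 := by
  obtain ⟨x, hx, hxJ⟩ := SetLike.exists_of_lt h.lt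
  have heq : J ⊔ Ideal.span {x} = J' := by
    refine (sup_le h.le ((Ideal.span_singleton_le_iff_mem _).2 hx)).eq_of_not_lt fun h' => h.2 ?_ h'
    exact left_lt_sup.2 fun hle => hxJ (hle (Ideal.mem_span_singleton_self _))
  have hmem : ∀ u : J.annihilator, (u : B) * x ∈ Ideal.span {y} := fun u => hsoc _ fun b hb => by
    have := Submodule.mem_annihilator.1 u.2 _ (Ideal.mul_mem_of_covBy h hb hx)
    rw [smul_eq_mul] at this
    linear_combination this
  let f : J.annihilator →ₗ[B] Ideal.span {y} :=
    ((LinearMap.toSpanSingleton B B x).comp J.annihilator.subtype).codRestrict _ (by simpa using hmem)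
  have := isSimpleModule_iff_isAtom.2 (isAtom_span_singleton_of_socle hy0 hym)
  rw [Module.length_eq_add_of_exact (LinearMap.ker f).subtype f.rangeRestrict
    (Submodule.subtype_injective _) (LinearMap.surjective_rangeRestrict f)
    (by rw [LinearMap.exact_iff, LinearMap.ker_rangeRestrict, Submodule.range_subtype])]
  refine add_le_add ?_ ?_
  · have hker : ∀ u : LinearMap.ker f, ((u : J.annihilator) : B) ∈ J'.annihilator := by
      rintro ⟨⟨u, hu⟩, huf⟩
      have hux : u * x = 0 := by simpa [f, Subtype.ext_iff] using huf
      rw [← heq, Submodule.mem_annihilator]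
      intro z hz
      obtain ⟨j, hj, w, hw, rfl⟩ := Submodule.mem_sup.1 hz
      obtain ⟨c, rfl⟩ := Ideal.mem_span_singleton'.1 hw
      have := Submodule.mem_annihilator.1 hu j hj
      simp only [smul_eq_mul] at this ⊢
      linear_combination this + c * hux
    refine Module.length_le_of_injective
      ((J.annihilator.subtype.comp (LinearMap.ker f).subtype).codRestrict _ hker) ?_
    intro a b hab
    have hab' : ((a : J.annihilator) : B) = (b : J.annihilator) := by
      have h' := congrArg J'.annihilator.subtype hab
      exact h'
    exact Subtype.ext (Subtype.ext hab')
  · rw [← Module.length_eq_one B (Ideal.span {y})]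
    exact Module.length_le_of_injective (LinearMap.range f).subtype (Submodule.subtype_injective _)

theorem length_add_length_annihilator_mono_of_covBy [IsArtinianRing B]
    (hy0 : y ≠ 0) (hym : ∀ b ∈ maximalIdeal B, b * y = 0)
    (hsoc : ∀ z : B, (∀ b ∈ maximalIdeal B, b * z = 0) → z ∈ Ideal.span {y})
    {J J' : Ideal B} (h : J ⋖ J') :
    Module.length B J + Module.length B J.annihilator ≤
      Module.length B J' + Module.length B J'.annihilator := by
  have h1 : Module.length B J + 1 ≤ Module.length B J' := by
    rw [Module.length_submodule, Module.length_submodule]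
    exact Order.add_one_le_of_lt (Submodule.height_strictMono h.lt)
  calc _ ≤ Module.length B J + (Module.length B J'.annihilator + 1) := by
        gcongr; exact length_annihilator_le_of_covBy hy0 hym hsoc h
    _ = (Module.length B J + 1) + Module.length B J'.annihilator := by ring
    _ ≤ _ := by gcongr

theorem length_add_length_annihilator [IsArtinianRing B]
    (hy0 : y ≠ 0) (hym : ∀ b ∈ maximalIdeal B, b * y = 0)
    (hsoc : ∀ z : B, (∀ b ∈ maximalIdeal B, b * z = 0) → z ∈ Ideal.span {y}) (J : Ideal B) :
    Module.length B J + Module.length B J.annihilator = Module.length B B := by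
  have htop : Module.length B (⊤ : Ideal B) + Module.length B (⊤ : Ideal B).annihilator =
      Module.length B B := by
    have h0 : (⊤ : Ideal B).annihilator = ⊥ :=
      (Submodule.eq_bot_iff _).2 fun b hb => by
        simpa using Submodule.mem_annihilator.1 hb 1 Submodule.mem_top
    rw [h0]
    simp
  have hbot : Module.length B (⊥ : Ideal B) + Module.length B (⊥ : Ideal B).annihilator =
      Module.length B B := by
    have h0 : (⊥ : Ideal B).annihilator = ⊤ := Submodule.annihilator_bot
    rw [h0]
    simp
  apply le_antisymm
  · induction J using WellFoundedGT.induction with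
    | ind J ih =>
      rcases eq_or_lt_of_le (le_top : J ≤ ⊤) with rfl | hJ
      · exact htop.le
      · obtain ⟨J', hJ', -⟩ := exists_covBy_le_of_lt hJ
        exact (length_add_length_annihilator_mono_of_covBy hy0 hym hsoc hJ').trans (ih J' hJ'.lt)
  · induction J using WellFoundedLT.induction with
    | ind J ih =>
      rcases eq_or_lt_of_le (bot_le : ⊥ ≤ J) with rfl | hJ
      · exact hbot.ge
      · obtain ⟨J', -, hJ'⟩ := exists_le_covBy_of_lt hJ
        exact (ih J' hJ'.lt).trans (length_add_length_annihilator_mono_of_covBy hy0 hym hsoc hJ')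

/-- An Artinian local ring with simple socle generated by `y` satisfies Gorenstein duality: any
`x` outside an ideal `J` is carried to `y` by an element killing `J`. -/
theorem exists_mul_eq_socle_of_notMem [IsArtinianRing B]
    (hy0 : y ≠ 0) (hym : ∀ b ∈ maximalIdeal B, b * y = 0)
    (hsoc : ∀ z : B, (∀ b ∈ maximalIdeal B, b * z = 0) → z ∈ Ideal.span {y})
    {J : Ideal B} {x : B} (hx : x ∉ J) : ∃ w ∈ J.annihilator, w * x = y := by
  have hlt : J < J ⊔ Ideal.span {x} :=
    left_lt_sup.2 fun hle => hx (hle (Ideal.mem_span_singleton_self _))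
  obtain ⟨J', hJJ', hJ'⟩ := exists_covBy_le_of_lt hlt
  have hne : ¬ J.annihilator ≤ J'.annihilator := by
    intro hle
    have heq : J.annihilator = J'.annihilator :=
      le_antisymm hle (Submodule.annihilator_mono hJJ'.le)
    have h1 := length_add_length_annihilator hy0 hym hsoc J
    have h2 := length_add_length_annihilator hy0 hym hsoc J'
    rw [heq, ← h2] at h1
    replace h1 := (ENat.add_left_injective_of_ne_top Module.length_ne_top) h1
    rw [Module.length_submodule, Module.length_submodule] at h1
    exact (Submodule.height_strictMono hJJ'.lt).ne h1
  obtain ⟨u, hu, huJ'⟩ := SetLike.not_le_iff_exists.1 hne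
  rw [Submodule.mem_annihilator] at huJ'
  push Not at huJ'
  obtain ⟨z, hz, hz0⟩ := huJ'
  obtain ⟨j, hj, v, hv, rfl⟩ := Submodule.mem_sup.1 (hJ' hz)
  obtain ⟨c, rfl⟩ := Ideal.mem_span_singleton'.1 hv
  have huj := Submodule.mem_annihilator.1 hu j hj
  have hkill : ∀ b ∈ maximalIdeal B, b * (u * (c * x)) = 0 := by
    intro b hb
    have h1 := Submodule.mem_annihilator.1 hu _ (Ideal.mul_mem_of_covBy hJJ' hb hz)
    simp only [smul_eq_mul] at h1 huj
    linear_combination h1 - b * huj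
  obtain ⟨a, ha⟩ := Ideal.mem_span_singleton'.1 (hsoc _ hkill)
  have hau : IsUnit a := by
    by_contra hn
    apply hz0
    simp only [smul_eq_mul] at huj ⊢
    rw [mul_add, huj, ← ha, hym a hn, add_zero]
  obtain ⟨a, rfl⟩ := hau
  refine ⟨(↑a⁻¹ * c) * u, Ideal.mul_mem_left _ _ hu, ?_⟩
  calc ↑a⁻¹ * c * u * x = ↑a⁻¹ * (u * (c * x)) := by ring
    _ = y := by rw [← ha, Units.inv_mul_cancel_left]

end Duality

theorem IsSocleGenerator.exists_mul_sub_mem {T : Type*} [CommRing T] [IsLocalRing T]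
    [IsNoetherianRing T] {I J : Ideal T} {x y : T} (hrad : I.radical = maximalIdeal T)
    (hy : IsSocleGenerator I y) (hIJ : I ≤ J) (hx : x ∉ J) :
    ∃ w, (∀ j ∈ J, w * j ∈ I) ∧ w * x - y ∈ I := by
  have hIm : I ≤ maximalIdeal T := hrad ▸ Ideal.le_radical
  have hItop : I ≠ ⊤ := fun h => (maximalIdeal.isMaximal T).ne_top (top_le_iff.1 (h ▸ hIm))
  have : Nontrivial (T ⧸ I) := Ideal.Quotient.nontrivial_iff.2 hItop
  have : IsLocalRing (T ⧸ I) :=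
    IsLocalRing.of_surjective' (Ideal.Quotient.mk I) Ideal.Quotient.mk_surjective
  have hmax : ∀ t : T, Ideal.Quotient.mk I t ∈ maximalIdeal (T ⧸ I) ↔ t ∈ maximalIdeal T := by
    intro t
    have := IsLocalHom.of_surjective (Ideal.Quotient.mk I) Ideal.Quotient.mk_surjective
    simp only [mem_maximalIdeal, mem_nonunits_iff, isUnit_map_iff]
  have : IsArtinianRing (T ⧸ I) := by
    rw [isArtinianRing_iff_isNilpotent_maximalIdeal]
    obtain ⟨n, hn⟩ := Ideal.exists_radical_pow_le_of_fg I (IsNoetherian.noetherian _)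
    refine ⟨n, ?_⟩
    have hmap : maximalIdeal (T ⧸ I) = (maximalIdeal T).map (Ideal.Quotient.mk I) := by
      ext z
      obtain ⟨t, rfl⟩ := Ideal.Quotient.mk_surjective z
      rw [hmax, Ideal.mem_quotient_iff_mem hIm]
    rw [hmap, ← Ideal.map_pow, Ideal.zero_eq_bot, Ideal.map_eq_bot_iff_le_ker, Ideal.mk_ker, ← hrad]
    exact hn
  have hcolon : ∀ z : T, z ∈ I.colon (maximalIdeal T) ↔ ∀ b ∈ maximalIdeal T, b * z ∈ I := by
    intro z
    simp [Submodule.mem_colon, mul_comm]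
  obtain ⟨w, hw, hwx⟩ := exists_mul_eq_socle_of_notMem (B := T ⧸ I)
    (y := Ideal.Quotient.mk I y) (J := J.map (Ideal.Quotient.mk I)) (x := Ideal.Quotient.mk I x)
    (fun h => hy.1 (Ideal.Quotient.eq_zero_iff_mem.1 h))
    (by
      intro b hb
      obtain ⟨b, rfl⟩ := Ideal.Quotient.mk_surjective b
      rw [← map_mul, Ideal.Quotient.eq_zero_iff_mem]
      refine (hcolon y).1 ?_ b ((hmax b).1 hb)
      rw [hy.2]
      exact Ideal.mem_sup_right (Ideal.mem_span_singleton_self y))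
    (by
      intro z hz
      obtain ⟨z, rfl⟩ := Ideal.Quotient.mk_surjective z
      have : z ∈ I ⊔ Ideal.span {y} := by
        rw [← hy.2, hcolon]
        intro b hb
        rw [← Ideal.Quotient.eq_zero_iff_mem, map_mul]
        exact hz _ ((hmax b).2 hb)
      obtain ⟨i, hi, v, hv, rfl⟩ := Submodule.mem_sup.1 this
      obtain ⟨c, rfl⟩ := Ideal.mem_span_singleton'.1 hv
      rw [map_add, Ideal.Quotient.eq_zero_iff_mem.2 hi, zero_add, map_mul]
      exact Ideal.mul_mem_left _ _ (Ideal.mem_span_singleton_self _))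
    (by rwa [Ideal.mem_quotient_iff_mem hIJ])
  obtain ⟨w, rfl⟩ := Ideal.Quotient.mk_surjective w
  refine ⟨w, fun j hj => ?_, ?_⟩
  · rw [← Ideal.Quotient.eq_zero_iff_mem, map_mul]
    exact Submodule.mem_annihilator.1 hw _ (Ideal.mem_map_of_mem _ hj)
  · rw [← Ideal.Quotient.eq, map_mul, hwx]

theorem Ideal.pow_mem_frobPow {R : Type*} [CommRing R] {I : Ideal R} {x : R} (hx : x ∈ I) (q : ℕ) :
    x ^ q ∈ I.frobPow q :=
  Ideal.subset_span ⟨x, hx, rfl⟩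

theorem Ideal.map_frobPow_le {R S : Type*} [CommRing R] [CommRing S] (f : R →+* S)
    {I : Ideal R} {J : Ideal S} (h : ∀ x ∈ I, f x ∈ J) {q : ℕ} {z : R} (hz : z ∈ I.frobPow q) :
    f z ∈ J.frobPow q := by
  have hle : I.frobPow q ≤ (J.frobPow q).comap f := by
    refine Ideal.span_le.2 ?_
    rintro _ ⟨r, hr, rfl⟩
    simpa using Ideal.pow_mem_frobPow (h r hr) q
  exact hle hz

theorem Ideal.pow_mul_mem_frobPow {R : Type*} [CommRing R] {I J : Ideal R} {w : R}
    (h : ∀ j ∈ J, w * j ∈ I) {q : ℕ} {z : R} (hz : z ∈ J.frobPow q) :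
    w ^ q * z ∈ I.frobPow q := by
  induction hz using Submodule.span_induction with
  | mem x hx =>
    obtain ⟨r, hr, rfl⟩ := hx
    simpa [mul_pow] using Ideal.pow_mem_frobPow (h r hr) q
  | zero => simp
  | add a b _ _ ha hb => rw [mul_add]; exact add_mem ha hb
  | smul a b _ hb => rw [smul_eq_mul, mul_left_comm]; exact Ideal.mul_mem_left _ _ hb

/-- Tight closure descends from an arbitrary ideal to the members of an approximately Gorenstein
sequence: the multiplier `c` lands in some `M_{I_s,y_s}`. -/
theorem exists_mem_MIy_of_notMem {T : Type*} [CommRing T] [IsLocalRing T] [IsNoetherianRing T]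
    (p : ℕ) [Fact p.Prime] [CharP T p] {I : ℕ → Ideal T} (hI : IsApproxGorensteinSeq T I)
    {y : ℕ → T} (hy : ∀ s, IsSocleGenerator (I s) (y s)) {J : Ideal T} {x c : T} (hx : x ∉ J)
    {E : ℕ} (hc : ∀ e, E ≤ e → c * x ^ p ^ e ∈ J.frobPow (p ^ e)) :
    ∃ s, c ∈ MIy p (I s) (y s) := by
  obtain ⟨n, hn⟩ : ∃ n : ℕ, x ∉ J ⊔ maximalIdeal T ^ n := by
    by_cases hJ : J = ⊤
    · exact absurd (hJ ▸ Submodule.mem_top) hx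
    by_contra! hall
    apply hx
    have : Nontrivial (T ⧸ J) := Ideal.Quotient.nontrivial_iff.2 hJ
    have : IsLocalRing (T ⧸ J) :=
      IsLocalRing.of_surjective' (Ideal.Quotient.mk J) Ideal.Quotient.mk_surjective
    have hbot := Ideal.iInf_pow_eq_bot_of_isLocalRing
      ((maximalIdeal T).map (Ideal.Quotient.mk J)) (by
        intro htop
        rw [Ideal.eq_top_iff_one, ← map_one (Ideal.Quotient.mk J),
          Ideal.mem_quotient_iff_mem (le_maximalIdeal hJ)] at htop
        exact (Ideal.ne_top_iff_one _).1 (maximalIdeal.isMaximal T).ne_top htop)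
    rw [← Ideal.Quotient.eq_zero_iff_mem, ← Ideal.mem_bot, ← hbot, Ideal.mem_iInf]
    intro n
    rw [← Ideal.map_pow, Ideal.mem_map_iff_of_surjective _ Ideal.Quotient.mk_surjective]
    obtain ⟨j, hj, z, hz, rfl⟩ := Submodule.mem_sup.1 (hall n)
    exact ⟨z, hz, by rw [map_add, Ideal.Quotient.eq_zero_iff_mem.2 hj, zero_add]⟩
  obtain ⟨S, hS⟩ := hI.2.2.2 n
  obtain ⟨w, hw, hwx⟩ := (hy S).exists_mul_sub_mem (hI.2.1 S)
    ((hS S le_rfl).trans le_sup_right) hn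
  refine ⟨S, max E 1, le_max_right _ _, fun f hf => ?_⟩
  have hcf := hc f ((le_max_left _ _).trans hf)
  have h1 : w ^ p ^ f * (c * x ^ p ^ f) ∈ (I S).frobPow (p ^ f) :=
    Ideal.pow_mul_mem_frobPow (fun j hj => hw j (Ideal.mem_sup_left hj)) hcf
  have h2 : (w * x - y S) ^ p ^ f ∈ (I S).frobPow (p ^ f) := Ideal.pow_mem_frobPow hwx _
  rw [sub_pow_char_pow, mul_pow] at h2
  have := sub_mem h1 (Ideal.mul_mem_left _ c h2)
  convert this using 1
  ring

section Precompletion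

variable {T : Type*} [CommRing T] {A : Subring T}

theorem Subring.isNoetherianRing_of_fg_closed [IsNoetherianRing T]
    (hcl : ∀ J : Ideal A, J.FG → ∀ c : A, (c : T) ∈ J.map A.subtype → c ∈ J) :
    IsNoetherianRing A := by
  classical
  refine ⟨fun J => ?_⟩
  have hfg : (Submodule.span T (A.subtype '' (J : Set A))).FG := IsNoetherian.noetherian _
  obtain ⟨S, hSJ, hS⟩ := (Submodule.fg_span_iff_fg_span_finset_subset _).1 hfg
  obtain ⟨S', hS'J, rfl⟩ := Finset.subset_set_image_iff.1 hSJ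
  have hmap : Ideal.map A.subtype J = (Ideal.span (S' : Set A)).map A.subtype := by
    rw [Ideal.map_span]
    exact hS.trans (by rw [Finset.coe_image])
  refine ⟨S', le_antisymm (Ideal.span_le.2 hS'J) fun c hc => ?_⟩
  exact hcl _ ⟨S', rfl⟩ c (hmap ▸ Ideal.mem_map_of_mem A.subtype hc)

variable [IsLocalRing T]

theorem Subring.isUnit_of_fg_closed
    (hcl : ∀ J : Ideal A, J.FG → ∀ c : A, (c : T) ∈ J.map A.subtype → c ∈ J)
    {a : A} (ha : (a : T) ∉ maximalIdeal T) : IsUnit a := by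
  have hu : IsUnit (a : T) := by simpa using ha
  rw [← Ideal.span_singleton_eq_top, Ideal.eq_top_iff_one]
  refine hcl _ ⟨{a}, by simp⟩ 1 ?_
  have htop : Ideal.span {A.subtype a} = ⊤ := Ideal.span_singleton_eq_top.2 hu
  rw [Ideal.map_span, Set.image_singleton, htop]
  trivial

theorem Subring.isLocalRing_of_fg_closed
    (hcl : ∀ J : Ideal A, J.FG → ∀ c : A, (c : T) ∈ J.map A.subtype → c ∈ J) :
    IsLocalRing A := by
  refine IsLocalRing.of_nonunits_add fun a b ha hb => ?_
  have ha' : (a : T) ∈ maximalIdeal T := by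
    by_contra h
    exact ha (isUnit_of_fg_closed hcl h)
  have hb' : (b : T) ∈ maximalIdeal T := by
    by_contra h
    exact hb (isUnit_of_fg_closed hcl h)
  exact fun hab => (add_mem ha' hb' : (a : T) + b ∈ maximalIdeal T) (hab.map A.subtype)

theorem Subring.isMaximal_comap_of_fg_closed
    (hcl : ∀ J : Ideal A, J.FG → ∀ c : A, (c : T) ∈ J.map A.subtype → c ∈ J) :
    (Ideal.comap A.subtype (maximalIdeal T)).IsMaximal := by
  refine Ideal.isMaximal_iff.2 ⟨fun h => ?_, fun J x hJ hx hxJ => ?_⟩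
  · exact (Ideal.ne_top_iff_one _).1 (maximalIdeal.isMaximal T).ne_top h
  · exact (Ideal.eq_top_iff_one J).1 (J.eq_top_of_isUnit_mem hxJ (isUnit_of_fg_closed hcl hx))

variable [IsNoetherianRing T]

theorem Subring.map_comap_maximalIdeal (hsurj : ∀ u : T, ∃ x ∈ A, x - u ∈ maximalIdeal T ^ 2) :
    (Ideal.comap A.subtype (maximalIdeal T)).map A.subtype = maximalIdeal T := by
  refine le_antisymm Ideal.map_comap_le ?_
  refine Submodule.le_of_le_smul_of_le_jacobson_bot (I := maximalIdeal T)
    (IsNoetherian.noetherian _) (maximalIdeal_le_jacobson _) ?_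
  intro u hu
  obtain ⟨x, hxA, hx⟩ := hsurj u
  have hxm : x ∈ maximalIdeal T := by
    simpa using add_mem (Ideal.pow_le_self two_ne_zero hx) hu
  refine Submodule.mem_sup.2 ⟨x, ?_, u - x, ?_, by ring⟩
  · have hx' : (⟨x, hxA⟩ : A) ∈ Ideal.comap A.subtype (maximalIdeal T) := hxm
    exact Ideal.mem_map_of_mem A.subtype hx'
  · rw [smul_eq_mul, ← pow_two]
    simpa using neg_mem hx

theorem Subring.exists_sub_mem_pow (hsurj : ∀ u : T, ∃ x ∈ A, x - u ∈ maximalIdeal T ^ 2)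
    (n : ℕ) (t : T) : ∃ a : A, (a : T) - t ∈ maximalIdeal T ^ n := by
  induction n generalizing t with
  | zero => exact ⟨0, by simp⟩
  | succ n ih =>
    obtain ⟨a, ha⟩ := ih t
    suffices h : ∀ z ∈ maximalIdeal T ^ n, ∃ b : A, (b : T) - z ∈ maximalIdeal T ^ (n + 1) by
      obtain ⟨b, hb⟩ := h _ ha
      refine ⟨a - b, ?_⟩
      convert neg_mem hb using 1
      push_cast
      ring
    intro z hz
    have hpow : maximalIdeal T ^ n =
        Ideal.span (A.subtype '' ((Ideal.comap A.subtype (maximalIdeal T)) ^ n : Ideal A)) := by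
      conv_lhs => rw [← map_comap_maximalIdeal hsurj, ← Ideal.map_pow]
      rfl
    rw [hpow] at hz
    induction hz using Submodule.span_induction with
    | mem x hx =>
      obtain ⟨b, -, rfl⟩ := hx
      exact ⟨b, by simp⟩
    | zero => exact ⟨0, by simp⟩
    | add x x' _ _ hx hx' =>
      obtain ⟨b, hb⟩ := hx
      obtain ⟨b', hb'⟩ := hx'
      refine ⟨b + b', ?_⟩
      convert add_mem hb hb' using 1
      push_cast
      ring
    | smul u x hxs hx =>
      obtain ⟨b, hb⟩ := hx
      obtain ⟨v, hvA, hv⟩ := hsurj u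
      refine ⟨⟨v, hvA⟩ * b, ?_⟩
      have hxn : x ∈ maximalIdeal T ^ n := by rw [hpow]; exact hxs
      have h1 : x * (v - u) ∈ maximalIdeal T ^ (n + 1) := by
        rw [pow_succ]
        exact Ideal.mul_mem_mul hxn (Ideal.pow_le_self two_ne_zero hv)
      convert add_mem (Ideal.mul_mem_left _ v hb) h1 using 1
      push_cast
      rw [smul_eq_mul]
      ring

theorem Subring.mem_pow_comap_iff (hsurj : ∀ u : T, ∃ x ∈ A, x - u ∈ maximalIdeal T ^ 2)
    (hcl : ∀ J : Ideal A, J.FG → ∀ c : A, (c : T) ∈ J.map A.subtype → c ∈ J) (n : ℕ) (a : A) :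
    a ∈ Ideal.comap A.subtype (maximalIdeal T) ^ n ↔ (a : T) ∈ maximalIdeal T ^ n := by
  have := isNoetherianRing_of_fg_closed hcl
  have hpow : (Ideal.comap A.subtype (maximalIdeal T) ^ n).map A.subtype = maximalIdeal T ^ n := by
    rw [Ideal.map_pow, map_comap_maximalIdeal hsurj]
  rw [← hpow]
  exact ⟨fun h => Ideal.mem_map_of_mem A.subtype h, hcl _ (IsNoetherian.noetherian _) a⟩

theorem Subring.nonempty_adicCompletion_ringEquiv [IsAdicComplete (maximalIdeal T) T]
    (hsurj : ∀ u : T, ∃ x ∈ A, x - u ∈ maximalIdeal T ^ 2)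
    (hcl : ∀ J : Ideal A, J.FG → ∀ c : A, (c : T) ∈ J.map A.subtype → c ∈ J) :
    Nonempty (AdicCompletion (Ideal.comap A.subtype (maximalIdeal T)) A ≃+* T) := by
  set m := maximalIdeal T with hm
  set n := Ideal.comap A.subtype m with hn
  have hmem : ∀ (i : ℕ) (a : A), a ∈ n ^ i ↔ (a : T) ∈ m ^ i := mem_pow_comap_iff hsurj hcl
  let g : ∀ i, A ⧸ n ^ i →+* T ⧸ m ^ i := fun i =>
    Ideal.quotientMap (m ^ i) A.subtype fun a ha => (hmem i a).1 ha
  have hg : ∀ i, Function.Injective (g i) := fun i =>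
    Ideal.quotientMap_injective' fun a ha => (hmem i a).2 ha
  let f : ∀ i, AdicCompletion n A →+* T ⧸ m ^ i := fun i =>
    (g i).comp (AdicCompletion.evalₐ n i).toRingHom
  have hfmk : ∀ i x, f i (AdicCompletion.mk n A x) = Ideal.Quotient.mk (m ^ i) (x i : T) := by
    intro i x
    have : f i (AdicCompletion.mk n A x) = g i (Ideal.Quotient.mk (n ^ i) (x i)) :=
      congrArg (g i) (AdicCompletion.evalₐ_mk n i x)
    exact this
  have hf : ∀ {i j : ℕ} (hle : i ≤ j), (Ideal.Quotient.factorPow m hle).comp (f j) = f i := by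
    intro i j hle
    ext x
    obtain ⟨x, rfl⟩ := AdicCompletion.mk_surjective n A x
    rw [RingHom.comp_apply, hfmk, hfmk]
    exact congrArg (g i) (AdicCompletion.Ideal.mk_eq_mk n hle x)
  let F := IsAdicComplete.liftRingHom m f hf
  have hF : ∀ i x, Ideal.Quotient.mk (m ^ i) (F x) = f i x := fun i x =>
    IsAdicComplete.mk_liftRingHom m f hf i x
  refine ⟨RingEquiv.ofBijective F ⟨?_, ?_⟩⟩
  · intro x x' hxx
    refine AdicCompletion.ext_evalₐ fun i => hg i ?_
    change f i x = f i x'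
    rw [← hF, ← hF, hxx]
  · intro t
    choose a ha using fun i => exists_sub_mem_pow hsurj i t
    have hcauchy : ∀ i, a i ≡ a (i + 1) [SMOD (n ^ i • ⊤ : Submodule A A)] := by
      intro i
      rw [SModEq.sub_mem, smul_eq_mul, Ideal.mul_top, hmem]
      convert sub_mem (ha i) (Ideal.pow_le_pow_right i.le_succ (ha (i + 1))) using 1
      push_cast
      ring
    refine ⟨AdicCompletion.mk n A (AdicCompletion.AdicCauchySequence.mk n A a hcauchy), ?_⟩
    rw [← sub_eq_zero]
    refine IsHausdorff.haus (IsAdicComplete.toIsHausdorff (I := m)) _ fun i => ?_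
    rw [SModEq.zero, smul_eq_mul, Ideal.mul_top, ← Ideal.Quotient.eq, hF, hfmk]
    exact Ideal.Quotient.eq.2 (ha i)

end Precompletion

section TransfiniteConstruction

universe u

open Cardinal

theorem Subring.cardinalMk_closure_le {T : Type u} [CommRing T] (s : Set T) :
    #(Subring.closure s) ≤ max #s ℵ₀ := by
  have h := Algebra.lift_cardinalMk_adjoin_le ℤ s
  rw [Algebra.adjoin_int] at h
  simpa [max_comm] using h

/-- Transfinite bookkeeping: inside a set `G`, a subring meeting all of a family of at most `κ`
requirements exists as soon as each requirement can be met over every subring of `G` of size less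
than `κ` by adjoining finitely many elements. A requirement `D t` is only active once the finite
set `pre t` is contained in the subring. -/
theorem Subring.exists_of_forall_finite_extension {T : Type u} [CommRing T] {G : Set T}
    (hbase : (Subring.closure (∅ : Set T) : Set T) ⊆ G) {κ : Cardinal.{u}} (hκ : ℵ₀ < κ)
    {τ : Type u} (hτ : #τ ≤ κ) (pre : τ → Set T) (hpre : ∀ t, (pre t).Finite)
    (D : τ → Subring T → Prop) (hmono : ∀ t, Monotone (D t))
    (step : ∀ t (R : Subring T), (R : Set T) ⊆ G → #R < κ → pre t ⊆ R →
      ∃ F : Set T, F.Finite ∧ (Subring.closure (R ∪ F) : Set T) ⊆ G ∧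
        D t (Subring.closure (R ∪ F))) :
    ∃ A : Subring T, (A : Set T) ⊆ G ∧ ∀ t, pre t ⊆ A → D t A := by
  classical
  rcases isEmpty_or_nonempty τ with hempty | hne
  · exact ⟨_, hbase, fun t => isEmptyElim t⟩
  let Ω := κ.ord.ToType
  have hΩ : #Ω = κ := mk_ord_toType κ
  have hIio : ∀ α : Ω, #(Set.Iio α) < κ := fun α => by simpa [Ω] using mk_Iio_lt α
  have hΩne : Nonempty Ω := by
    rw [← mk_ne_zero_iff, hΩ]
    exact (aleph0_pos.trans hκ).ne'
  obtain ⟨e⟩ : Nonempty (Ω ≃ Ω × τ) := by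
    rw [← Cardinal.eq, mk_prod, lift_id, lift_id, hΩ,
      mul_eq_left hκ.le hτ (mk_ne_zero τ)]
  have hΦ : ∀ t (R : Subring T), ∃ F : Set T, F.Finite ∧
      ((R : Set T) ⊆ G → (Subring.closure (R ∪ F) : Set T) ⊆ G ∧
        (#R < κ → pre t ⊆ R → D t (Subring.closure (R ∪ F)))) := by
    intro t R
    by_cases h : (R : Set T) ⊆ G ∧ #R < κ ∧ pre t ⊆ R
    · obtain ⟨F, hF, h1, h2⟩ := step t R h.1 h.2.1 h.2.2
      exact ⟨F, hF, fun _ => ⟨h1, fun _ _ => h2⟩⟩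
    · exact ⟨∅, Set.finite_empty, fun hR => ⟨by simpa using hR, fun h1 h2 => (h ⟨hR, h1, h2⟩).elim⟩⟩
  choose Φ hΦfin hΦ using hΦ
  let F : Ω → Set T := (wellFounded_lt (α := Ω)).fix fun α ih =>
    Φ (e α).2 (Subring.closure (⋃ β : Set.Iio α, ih β.1 β.2))
  let R : Ω → Subring T := fun α => Subring.closure (⋃ β : Set.Iio α, F β)
  have hF : ∀ α, F α = Φ (e α).2 (R α) := fun α => WellFounded.fix_eq _ _ α
  let S : Ω → Subring T := fun α => Subring.closure (R α ∪ F α)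
  have hRS : ∀ α, R α ≤ S α := fun α x hx => Subring.subset_closure (Or.inl hx)
  have hSR : ∀ {α β}, β < α → S β ≤ R α := by
    intro α β hβ
    refine Subring.closure_le.2 (Set.union_subset (Subring.closure_le.2 ?_) ?_)
    · refine Set.iUnion_subset fun γ => ?_
      exact (Set.subset_iUnion (fun γ : Set.Iio α => F γ) ⟨γ.1, lt_trans γ.2 hβ⟩).trans
        Subring.subset_closure
    · exact (Set.subset_iUnion (fun γ : Set.Iio α => F γ) ⟨β, hβ⟩).trans Subring.subset_closure
  have hSmono : Monotone S := by
    intro β α hβ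
    rcases hβ.eq_or_lt with rfl | h
    · exact le_rfl
    · exact (hSR h).trans (hRS α)
  have hRG : ∀ α, (R α : Set T) ⊆ G := by
    intro α
    induction α using WellFoundedLT.induction with
    | ind α ih =>
      rcases isEmpty_or_nonempty (Set.Iio α) with hα | hα
      · have : R α = Subring.closure ∅ := congrArg Subring.closure (Set.iUnion_of_empty _)
        rw [this]
        exact hbase
      · intro x hx
        have hle : R α ≤ ⨆ β : Set.Iio α, S β := by
          refine Subring.closure_le.2 (Set.iUnion_subset fun β y hy => ?_)
          exact (le_iSup (fun β : Set.Iio α => S β) β) (Subring.subset_closure (Or.inr hy))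
        have hdir : Directed (· ≤ ·) fun β : Set.Iio α => S β :=
          Monotone.directed_le fun β γ h => hSmono h
        obtain ⟨β, hβ⟩ := (Subring.mem_iSup_of_directed hdir).1 (hle hx)
        have := (hΦ (e β.1).2 (R β) (ih β β.2)).1
        rw [← hF] at this
        exact this hβ
  have hSG : ∀ α, (S α : Set T) ⊆ G := by
    intro α
    have := (hΦ (e α).2 (R α) (hRG α)).1
    rwa [← hF] at this
  have hRcard : ∀ α, #(R α) < κ := by
    intro α
    refine (Subring.cardinalMk_closure_le _).trans_lt (max_lt ?_ hκ)
    refine ((mk_iUnion_le_sum_mk).trans (sum_le_sum _ (fun _ => ℵ₀) fun β => ?_)).trans_lt ?_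
    · rw [hF]
      exact (hΦfin _ _).lt_aleph0.le
    · rw [sum_const, lift_id, lift_id]
      exact mul_lt_of_lt hκ.le (hIio α) hκ
  have hdir : Directed (· ≤ ·) S := hSmono.directed_le
  refine ⟨⨆ α, S α, fun x hx => ?_, fun t ht => ?_⟩
  · obtain ⟨α, hα⟩ := (Subring.mem_iSup_of_directed hdir).1 hx
    exact hSG α hα
  · obtain ⟨α, hα⟩ : ∃ α, pre t ⊆ S α := by
      have hex : ∀ x ∈ pre t, ∃ α, x ∈ S α := fun x hx =>
        (Subring.mem_iSup_of_directed hdir).1 (ht hx)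
      choose! i hi using hex
      obtain ⟨α, hα⟩ := ((hpre t).image i).bddAbove
      exact ⟨α, fun x hx => hSmono (hα ⟨x, hx, rfl⟩) (hi x hx)⟩
    obtain ⟨β, hαβ, hβ⟩ : ∃ β, α < β ∧ (e β).2 = t := by
      by_contra! hcon
      have hle : ∀ ω : Ω, e.symm (ω, t) ∈ Set.Iic α := fun ω =>
        not_lt.1 fun h => hcon _ h (by simp)
      have hinj : Function.Injective fun ω : Ω => (⟨e.symm (ω, t), hle ω⟩ : Set.Iic α) := by
        intro ω ω' h
        simpa using h
      have h1 := mk_le_of_injective hinj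
      rw [hΩ, ← Set.Iio_insert] at h1
      refine (h1.trans mk_insert_le).not_gt ?_
      exact add_lt_of_lt hκ.le (hIio α) (one_lt_aleph0.trans hκ)
    refine hmono t (le_iSup S β) ?_
    have := (hΦ (e β).2 (R β) (hRG β)).2 (hRcard β)
    rw [← hF, hβ] at this
    exact this (hα.trans (hSR hαβ))

theorem mk_le_mk_nat_arrow_residueField (T : Type u) [CommRing T] [IsLocalRing T]
    [IsNoetherianRing T] : #T ≤ #(ℕ → ResidueField T) := by
  obtain ⟨d, g, hg⟩ := Submodule.fg_iff_exists_fin_generating_family.1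
    (IsNoetherian.noetherian (maximalIdeal T))
  obtain ⟨r, hr⟩ := (residue_surjective (R := T)).hasRightInverse
  have hdigit : ∀ t : T, ∃ c : Fin d → T, ∑ i, c i * g i = t - r (residue T t) := by
    intro t
    rw [← Ideal.mem_span_range_iff_exists_fun]
    change _ ∈ Submodule.span T (Set.range g)
    rw [hg, ← residue_eq_zero_iff, map_sub, hr, sub_self]
  choose c hc using hdigit
  let φ : T → List (Fin d) → ResidueField T := fun t l => residue T (l.foldl c t)
  have hφ : ∀ (n : ℕ) (t t' : T), φ t = φ t' → t - t' ∈ maximalIdeal T ^ n := by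
    intro n
    induction n with
    | zero => simp
    | succ n ih =>
      intro t t' h
      have h0 : residue T t = residue T t' := congrFun h []
      have hi : ∀ i, c t i - c t' i ∈ maximalIdeal T ^ n := fun i =>
        ih _ _ (funext fun l => congrFun h (i :: l))
      have hsum : t - t' = ∑ i, (c t i - c t' i) * g i := by
        simp only [sub_mul, Finset.sum_sub_distrib, hc, h0]
        ring
      rw [hsum, pow_succ]
      refine sum_mem fun i _ => Ideal.mul_mem_mul (hi i) ?_
      rw [← hg]
      exact Submodule.subset_span ⟨i, rfl⟩
  have hinj : Function.Injective φ := by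
    intro t t' h
    have hmem : t - t' ∈ ⨅ n : ℕ, maximalIdeal T ^ n :=
      (Ideal.mem_iInf).2 fun n => hφ n t t' h
    rw [Ideal.iInf_pow_eq_bot_of_isLocalRing _ (maximalIdeal.isMaximal T).ne_top] at hmem
    exact sub_eq_zero.1 hmem
  refine (mk_le_of_injective hinj).trans ?_
  simp only [mk_pi, prod_const, lift_uzero, mk_nat, lift_aleph0]
  refine power_le_power_left (mk_ne_zero _) ?_
  simp

theorem aleph0_lt_mk_nat_arrow (k : Type u) [Nontrivial k] : ℵ₀ < #(ℕ → k) := by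
  simp only [mk_pi, prod_const, lift_uzero, mk_nat, lift_aleph0]
  refine (cantor ℵ₀).trans_le (power_le_power_right ?_)
  rw [two_le_iff]
  exact exists_pair_ne k

/-- For `z` in the maximal ideal of a complete local ring, power series in `z` with coefficients
representing the residue field give a family of elements of `m²`, indexed by sequences in the
residue field, whose differences avoid every prime that does not contain `z`. -/
theorem exists_family_sub_notMem {T : Type u} [CommRing T] [IsLocalRing T]
    [IsAdicComplete (maximalIdeal T) T] {z : T} (hz : z ∈ maximalIdeal T) :
    ∃ w : (ℕ → ResidueField T) → T, (∀ a, w a ∈ maximalIdeal T ^ 2) ∧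
      ∀ a b, a ≠ b → ∀ Q : Ideal T, Q.IsPrime → z ∉ Q → w a - w b ∉ Q := by
  obtain ⟨r, hr⟩ := (residue_surjective (R := T)).hasRightInverse
  let s : (ℕ → ResidueField T) → ℕ → T := fun a N => ∑ n ∈ Finset.range N, r (a n) * z ^ n
  have hlim : ∀ a, ∃ L : T, ∀ N, s a N - L ∈ maximalIdeal T ^ N := by
    intro a
    have hcauchy : ∀ {M N : ℕ}, M ≤ N →
        s a M ≡ s a N [SMOD (maximalIdeal T ^ M • ⊤ : Submodule T T)] := by
      intro M N hMN
      rw [SModEq.comm, SModEq.sub_mem, smul_eq_mul, Ideal.mul_top]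
      rw [← Finset.sum_Ico_eq_sub _ hMN]
      refine sum_mem fun n hn => Ideal.mul_mem_left _ _ ?_
      exact Ideal.pow_le_pow_right (Finset.mem_Ico.1 hn).1 (Ideal.pow_mem_pow hz n)
    obtain ⟨L, hL⟩ := IsPrecomplete.prec (IsAdicComplete.toIsPrecomplete) hcauchy
    refine ⟨L, fun N => ?_⟩
    have := hL N
    rwa [SModEq.sub_mem, smul_eq_mul, Ideal.mul_top] at this
  choose L hL using hlim
  have hshift : ∀ a, L a = r (a 0) + z * L fun n => a (n + 1) := by
    intro a
    rw [← sub_eq_zero]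
    refine IsHausdorff.haus (IsAdicComplete.toIsHausdorff (I := maximalIdeal T)) _ fun N => ?_
    rw [SModEq.zero, smul_eq_mul, Ideal.mul_top]
    have h1 : s a (N + 1) = r (a 0) + z * s (fun n => a (n + 1)) N := by
      simp only [s, Finset.sum_range_succ', Finset.mul_sum, pow_zero, mul_one]
      rw [add_comm]
      congr 1
      exact Finset.sum_congr rfl fun n _ => by ring
    have h2 := Ideal.pow_le_pow_right N.le_succ (hL a (N + 1))
    have h3 := Ideal.mul_mem_left _ z (hL (fun n => a (n + 1)) N)
    rw [h1] at h2
    convert sub_mem h3 h2 using 1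
    ring
  have hres : ∀ a, residue T (L a) = a 0 := by
    intro a
    rw [hshift, map_add, map_mul, hr, (residue_eq_zero_iff z).2 hz, zero_mul, add_zero]
  have hunit : ∀ a b (Q : Ideal T), Q.IsPrime → a 0 ≠ b 0 → L a - L b ∉ Q := by
    intro a b Q hQ hab hmem
    have := (residue_eq_zero_iff _).2 (le_maximalIdeal hQ.ne_top hmem)
    rw [map_sub, hres, hres] at this
    exact hab (sub_eq_zero.1 this)
  have hL' : ∀ (n : ℕ) a b (Q : Ideal T), Q.IsPrime → z ∉ Q → a n ≠ b n → L a - L b ∉ Q := by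
    intro n
    induction n with
    | zero => exact fun a b Q hQ _ hab => hunit a b Q hQ hab
    | succ n ih =>
      intro a b Q hQ hzQ hab
      by_cases h0 : a 0 = b 0
      · rw [hshift a, hshift b, h0, add_sub_add_left_eq_sub, ← mul_sub]
        exact fun h => (hQ.mem_or_mem h).elim hzQ (ih _ _ Q hQ hzQ hab)
      · exact hunit a b Q hQ h0
  refine ⟨fun a => z ^ 2 * L a, fun a => Ideal.mul_mem_right _ _ (Ideal.pow_mem_pow hz 2), ?_⟩
  intro a b hab Q hQ hzQ h
  obtain ⟨n, hn⟩ := Function.ne_iff.1 hab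
  rw [← mul_sub] at h
  exact (hQ.mem_or_mem h).elim (fun h => hzQ (hQ.mem_of_pow_mem 2 h)) (hL' n a b Q hQ hzQ hn)

/-- The elements that are zero or avoid every ideal of the family `C`. -/
def avoidingSet {T : Type u} [CommRing T] (C : Set (Ideal T)) : Set T :=
  {a | ∀ Q ∈ C, a ∈ Q → a = 0}

theorem exists_eval₂_of_mem_closure_insert {T : Type u} [CommRing T] {R : Subring T} {x a : T}
    (ha : a ∈ Subring.closure ((R : Set T) ∪ {x})) :
    ∃ f : Polynomial R, f.eval₂ R.subtype x = a := by
  have hle : Subring.closure ((R : Set T) ∪ {x}) ≤ (Polynomial.eval₂RingHom R.subtype x).range := by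
    refine Subring.closure_le.2 (Set.union_subset (fun b hb => ⟨Polynomial.C ⟨b, hb⟩, ?_⟩) ?_)
    · simp
    · rintro _ rfl
      exact ⟨Polynomial.X, by simp⟩
  exact hle ha

/-- A subring avoiding `C` stays so after adjoining `a + b * u` for a general `u ∈ m²`. -/
theorem exists_closure_union_subset_avoidingSet {T : Type u} [CommRing T] [IsLocalRing T]
    [IsAdicComplete (maximalIdeal T) T] {C : Set (Ideal T)} (hfin : C.Finite)
    (hprime : ∀ Q ∈ C, Q.IsPrime) {z : T} (hz : z ∈ maximalIdeal T) (hzC : ∀ Q ∈ C, z ∉ Q)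
    {R : Subring T} (hR : (R : Set T) ⊆ avoidingSet C) (hcard : #R < #(ℕ → ResidueField T))
    (a : T) {b : T} (hb : ∀ Q ∈ C, b ∉ Q) :
    ∃ u ∈ maximalIdeal T ^ 2,
      (Subring.closure ((R : Set T) ∪ {a + b * u}) : Set T) ⊆ avoidingSet C := by
  obtain ⟨w, hwm, hw⟩ := exists_family_sub_notMem hz
  let bad : Ideal T → Set (ℕ → ResidueField T) := fun Q =>
    {i | IsAlgebraic R (Ideal.Quotient.mk Q (a + b * w i))}
  have hbad : ∀ Q ∈ C, #(bad Q) ≤ max #R ℵ₀ := by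
    intro Q hQ
    have hQp := hprime Q hQ
    have hinj : Function.Injective (algebraMap R (T ⧸ Q)) := by
      rw [injective_iff_map_eq_zero]
      intro x hx
      exact Subtype.ext (hR x.2 Q hQ (Ideal.Quotient.eq_zero_iff_mem.1 hx))
    have : IsDomain R := hinj.isDomain (algebraMap R (T ⧸ Q))
    have : FaithfulSMul R (T ⧸ Q) := (faithfulSMul_iff_algebraMap_injective R (T ⧸ Q)).2 hinj
    refine le_trans ?_ (Algebraic.cardinalMk_le_max R (T ⧸ Q))
    refine mk_le_of_injective
      (f := fun i : bad Q => ⟨Ideal.Quotient.mk Q (a + b * w i), i.2⟩) ?_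
    intro i j hij
    by_contra hne
    have h1 := Ideal.Quotient.eq.1 (Subtype.ext_iff.1 hij)
    rw [add_sub_add_left_eq_sub, ← mul_sub] at h1
    exact (hQp.mem_or_mem h1).elim (hb Q hQ)
      (hw i j (fun h => hne (Subtype.ext h)) Q hQp (hzC Q hQ))
  have hunion : #(⋃ Q ∈ C, bad Q : Set (ℕ → ResidueField T)) < #(ℕ → ResidueField T) := by
    have hmax : max #R ℵ₀ < #(ℕ → ResidueField T) := max_lt hcard (aleph0_lt_mk_nat_arrow _)
    refine lt_of_le_of_lt ?_ hmax
    refine (mk_biUnion_le _ _).trans ?_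
    refine (mul_le_mul' (hfin.lt_aleph0.le.trans (le_max_right #R ℵ₀))
      (ciSup_le' fun Q : C => hbad Q.1 Q.2)).trans ?_
    rw [mul_eq_self (le_max_right _ _)]
  obtain ⟨i, hi⟩ : ∃ i, i ∉ ⋃ Q ∈ C, bad Q := by
    by_contra! hall
    rw [Set.eq_univ_of_forall hall, mk_univ] at hunion
    exact hunion.false
  refine ⟨w i, hwm i, fun x hx Q hQ hxQ => ?_⟩
  obtain ⟨f, rfl⟩ := exists_eval₂_of_mem_closure_insert hx
  have htr : ¬ IsAlgebraic R (Ideal.Quotient.mk Q (a + b * w i)) := fun h =>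
    hi (Set.mem_biUnion hQ h)
  have hf : f = 0 := by
    by_contra hf
    refine htr ⟨f, hf, ?_⟩
    rw [← Ideal.Quotient.eq_zero_iff_mem, Polynomial.hom_eval₂] at hxQ
    exact hxQ
  rw [hf, Polynomial.eval₂_zero]

/-- Adjoining a quotient `t = c / y` of elements of `R` preserves avoidance. -/
theorem closure_union_subset_avoidingSet_of_mul_mem {T : Type u} [CommRing T]
    {C : Set (Ideal T)} (hreg : ∀ a : T, (∀ Q ∈ C, a ∉ Q) → a ∈ nonZeroDivisors T)
    {R : Subring T} (hR : (R : Set T) ⊆ avoidingSet C) {t y : T} (hy : y ∈ R) (hy0 : y ≠ 0)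
    (hty : t * y ∈ R) :
    (Subring.closure ((R : Set T) ∪ {t}) : Set T) ⊆ avoidingSet C := by
  intro x hx Q hQ hxQ
  obtain ⟨f, rfl⟩ := exists_eval₂_of_mem_closure_insert hx
  have hyreg : y ∈ nonZeroDivisors T := hreg y fun Q hQ h => hy0 (hR hy Q hQ h)
  have hmem : f.eval₂ R.subtype t * y ^ f.natDegree ∈ R := by
    rw [Polynomial.eval₂_eq_sum_range, Finset.sum_mul]
    refine sum_mem fun i hi => ?_
    obtain ⟨j, hj⟩ := Nat.exists_eq_add_of_le (Nat.lt_succ_iff.1 (Finset.mem_range.1 hi))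
    have : R.subtype (f.coeff i) * t ^ i * y ^ f.natDegree =
        R.subtype (f.coeff i) * ((t * y) ^ i * y ^ j) := by
      rw [hj]
      ring
    rw [this]
    exact mul_mem (f.coeff i).2 (mul_mem (pow_mem hty i) (pow_mem hy j))
  have h0 := hR hmem Q hQ (Q.mul_mem_right _ hxQ)
  exact (mul_right_mem_nonZeroDivisors_eq_zero_iff (pow_mem hyreg _)).1 h0

/-- `c` is a linear combination of the entries of the list with coefficients in `R`. -/
def Subring.IsCombination {T : Type u} [CommRing T] (R : Subring T) : List T → T → Prop
  | [], c => c = 0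
  | y :: L, c => ∃ t ∈ R, R.IsCombination L (c - t * y)

theorem Subring.IsCombination.mono {T : Type u} [CommRing T] {R S : Subring T} (h : R ≤ S) :
    ∀ {L : List T} {c : T}, R.IsCombination L c → S.IsCombination L c
  | [], _, hc => hc
  | _ :: _, _, ⟨t, ht, hc⟩ => ⟨t, h ht, hc.mono h⟩

theorem Subring.isCombination_of_mem_span {T : Type u} [CommRing T] :
    ∀ {L : List T} {c : T}, c ∈ Ideal.span {y | y ∈ L} → (⊤ : Subring T).IsCombination L c
  | [], c, hc => by simpa [Subring.IsCombination] using hc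
  | y :: L, c, hc => by
    have hset : {x | x ∈ y :: L} = insert y {x | x ∈ L} := by
      ext x
      simp
    rw [hset, Ideal.mem_span_insert] at hc
    obtain ⟨t, d, hd, rfl⟩ := hc
    refine ⟨t, trivial, ?_⟩
    rw [add_sub_cancel_left]
    exact Subring.isCombination_of_mem_span hd

theorem Subring.IsCombination.mem {T : Type u} [CommRing T] {A : Subring T} {J : Ideal A} :
    ∀ {L : List T} {c : A}, (∀ y ∈ L, ∃ j ∈ J, (j : T) = y) → A.IsCombination L c → c ∈ J
  | [], c, _, hc => by
    have : c = 0 := Subtype.ext hc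
    exact this ▸ J.zero_mem
  | y :: L, c, hL, ⟨t, ht, hc⟩ => by
    obtain ⟨j, hj, rfl⟩ := hL y List.mem_cons_self
    have := Subring.IsCombination.mem (c := c - ⟨t, ht⟩ * j)
      (fun x hx => hL x (List.mem_cons_of_mem _ hx)) hc
    exact (Submodule.sub_mem_iff_left J (J.mul_mem_left _ hj)).1 this

theorem exists_finite_isCombination {T : Type u} [CommRing T] [IsLocalRing T]
    [IsAdicComplete (maximalIdeal T) T] {C : Set (Ideal T)} (hfin : C.Finite)
    (hprime : ∀ Q ∈ C, Q.IsPrime) {z : T} (hz : z ∈ maximalIdeal T) (hzC : ∀ Q ∈ C, z ∉ Q)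
    (hreg : ∀ a : T, (∀ Q ∈ C, a ∉ Q) → a ∈ nonZeroDivisors T) :
    ∀ {L : List T} {c : T} {R : Subring T}, (R : Set T) ⊆ avoidingSet C →
      #R < #(ℕ → ResidueField T) → (∀ y ∈ L, y ∈ R) → (∀ y ∈ L, y ≠ 0) → c ∈ R →
      (⊤ : Subring T).IsCombination L c →
      ∃ F : Set T, F.Finite ∧ (Subring.closure ((R : Set T) ∪ F) : Set T) ⊆ avoidingSet C ∧
        (Subring.closure ((R : Set T) ∪ F)).IsCombination L c
  | [], c, R, hR, _, _, _, _, hc => ⟨∅, Set.finite_empty, by simpa using hR, hc⟩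
  | [y], c, R, hR, _, hL, hL0, hcR, ⟨t, _, hc⟩ => by
    have hcy : c - t * y = 0 := hc
    refine ⟨{t}, Set.finite_singleton t, closure_union_subset_avoidingSet_of_mul_mem hreg hR
      (hL y (by simp)) (hL0 y (by simp)) ?_, t, Subring.subset_closure (Or.inr rfl), hc⟩
    rwa [← sub_eq_zero.1 hcy]
  | y₁ :: y₂ :: L, c, R, hR, hcard, hL, hL0, hcR, ⟨t₁, _, t₂, _, hc⟩ => by
    have hy₂ : ∀ Q ∈ C, y₂ ∉ Q := fun Q hQ h =>
      hL0 y₂ (by simp) (hR (hL y₂ (by simp)) Q hQ h)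
    obtain ⟨u, -, hu⟩ :=
      exists_closure_union_subset_avoidingSet hfin hprime hz hzC hR hcard t₁ hy₂
    set x := t₁ + y₂ * u with hx
    have hle : R ≤ Subring.closure ((R : Set T) ∪ {x}) := fun a ha =>
      Subring.subset_closure (Or.inl ha)
    have hxmem : x ∈ Subring.closure ((R : Set T) ∪ {x}) := Subring.subset_closure (Or.inr rfl)
    have hcard' : #(Subring.closure ((R : Set T) ∪ {x})) < #(ℕ → ResidueField T) := by
      have h0 := aleph0_lt_mk_nat_arrow (ResidueField T)
      refine (Subring.cardinalMk_closure_le _).trans_lt (max_lt ?_ h0)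
      refine (mk_union_le _ _).trans_lt (add_lt_of_lt h0.le hcard ?_)
      rw [mk_singleton]
      exact one_lt_aleph0.trans h0
    obtain ⟨F, hF, hFC, hcomb⟩ := exists_finite_isCombination hfin hprime hz hzC hreg
      (L := y₂ :: L) (c := c - x * y₁) hu hcard'
      (fun y hy => hle (hL y (List.mem_cons_of_mem _ hy)))
      (fun y hy => hL0 y (List.mem_cons_of_mem _ hy))
      (sub_mem (hle hcR) (mul_mem hxmem (hle (hL y₁ (by simp)))))
      ⟨t₂ - y₁ * u, trivial, by
        convert hc using 1
        rw [hx]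
        ring⟩
    have heq : Subring.closure ((Subring.closure ((R : Set T) ∪ {x}) : Set T) ∪ F) =
        Subring.closure ((R : Set T) ∪ insert x F) := by
      rw [Subring.closure_union, Subring.closure_eq, ← Subring.closure_union, Set.union_assoc,
        Set.singleton_union]
    rw [heq] at hFC hcomb
    exact ⟨insert x F, hF.insert x, hFC, x,
      Subring.subset_closure (Or.inr (Set.mem_insert x F)), hcomb⟩

/-- A complete local ring contains a subring avoiding a given finite set `C` of nonmaximal primes
which surjects onto `T / m²`, contracts finitely generated ideals to themselves, and contains
associates of countably many given elements outside `C`. -/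
theorem Subring.exists_fg_closed_subset_avoidingSet {T : Type u} [CommRing T] [IsLocalRing T]
    [IsNoetherianRing T] [IsAdicComplete (maximalIdeal T) T] {C : Set (Ideal T)} (hfin : C.Finite)
    (hprime : ∀ Q ∈ C, Q.IsPrime) {z : T} (hz : z ∈ maximalIdeal T) (hzC : ∀ Q ∈ C, z ∉ Q)
    (hreg : ∀ a : T, (∀ Q ∈ C, a ∉ Q) → a ∈ nonZeroDivisors T)
    (hbase : ((Subring.closure ∅ : Subring T) : Set T) ⊆ avoidingSet C)
    (v : ℕ → T) (hv : ∀ i, ∀ Q ∈ C, v i ∉ Q) :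
    ∃ A : Subring T, (A : Set T) ⊆ avoidingSet C ∧
      (∀ u : T, ∃ x ∈ A, x - u ∈ maximalIdeal T ^ 2) ∧
      (∀ J : Ideal A, J.FG → ∀ c : A, (c : T) ∈ J.map A.subtype → c ∈ J) ∧
      ∀ i, ∃ t : Tˣ, v i * (t : T) ∈ A := by
  have hκ := aleph0_lt_mk_nat_arrow (ResidueField T)
  have hT := mk_le_mk_nat_arrow_residueField T
  let τ := T ⊕ (List T × T) ⊕ ℕ
  have hτ : #τ ≤ #(ℕ → ResidueField T) := by
    have hlist : #(List T) ≤ #(ℕ → ResidueField T) :=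
      (mk_list_le_max T).trans (max_le hκ.le hT)
    simp only [τ, mk_sum, mk_prod, lift_id, lift_uzero, mk_nat, lift_aleph0]
    exact add_le_of_le hκ.le hT (add_le_of_le hκ.le
      ((mul_le_mul' hlist hT).trans (mul_eq_self hκ.le).le) hκ.le)
  let pre : τ → Set T := Sum.elim (fun _ => ∅) (Sum.elim (fun q => insert q.2 {y | y ∈ q.1})
    fun _ => ∅)
  let D : τ → Subring T → Prop := Sum.elim (fun u R => ∃ x ∈ R, x - u ∈ maximalIdeal T ^ 2)
    (Sum.elim (fun q R => (∀ y ∈ q.1, y ≠ 0) → (⊤ : Subring T).IsCombination q.1 q.2 →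
      R.IsCombination q.1 q.2) fun i R => ∃ t : Tˣ, v i * (t : T) ∈ R)
  obtain ⟨A, hA, hD⟩ := Subring.exists_of_forall_finite_extension hbase hκ hτ pre
    (by
      rintro (u | q | i)
      · exact Set.finite_empty
      · exact (List.finite_toSet q.1).insert _
      · exact Set.finite_empty)
    D
    (by
      rintro (u | q | i) R S hRS
      · exact fun ⟨x, hx, hxu⟩ => ⟨x, hRS hx, hxu⟩
      · exact fun h h0 hq => (h h0 hq).mono hRS
      · exact fun ⟨t, ht⟩ => ⟨t, hRS ht⟩)
    (by
      rintro (u | q | i) R hR hcard hpre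
      · obtain ⟨w, hw, hwC⟩ := exists_closure_union_subset_avoidingSet hfin hprime hz hzC hR hcard
          u (b := 1) fun Q hQ h => (hprime Q hQ).ne_top ((Ideal.eq_top_iff_one Q).2 h)
        refine ⟨_, Set.finite_singleton _, hwC, _, Subring.subset_closure (Or.inr rfl), ?_⟩
        rwa [one_mul, add_sub_cancel_left]
      · by_cases hq : (∀ y ∈ q.1, y ≠ 0) ∧ (⊤ : Subring T).IsCombination q.1 q.2
        · obtain ⟨F, hF, hFC, hcomb⟩ := exists_finite_isCombination hfin hprime hz hzC hreg hR hcard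
            (fun y hy => hpre (Set.mem_insert_of_mem _ hy)) hq.1 (hpre (Set.mem_insert _ _)) hq.2
          exact ⟨F, hF, hFC, fun _ _ => hcomb⟩
        · exact ⟨∅, Set.finite_empty, by simpa using hR, fun h h' => absurd ⟨h, h'⟩ hq⟩
      · obtain ⟨w, hw, hwC⟩ := exists_closure_union_subset_avoidingSet hfin hprime hz hzC hR hcard
          (v i) (hv i)
        have hunit : IsUnit (1 + w) := by
          have hwm : -w ∈ maximalIdeal T := neg_mem (Ideal.pow_le_self two_ne_zero hw)
          have := isUnit_one_sub_self_of_mem_nonunits _ ((mem_maximalIdeal _).1 hwm)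
          rwa [sub_neg_eq_add] at this
        refine ⟨_, Set.finite_singleton _, hwC, hunit.unit, Subring.subset_closure (Or.inr ?_)⟩
        rw [IsUnit.unit_spec, Set.mem_singleton_iff]
        ring)
  refine ⟨A, hA, fun u => hD (Sum.inl u) (Set.empty_subset _), fun J hJ c hc => ?_,
    fun i => hD (Sum.inr (Sum.inr i)) (Set.empty_subset _)⟩
  classical
  obtain ⟨S, rfl⟩ := hJ
  let L : List T := ((S.erase 0).image A.subtype).toList
  have hL : ∀ y, y ∈ L ↔ ∃ j ∈ S, j ≠ 0 ∧ (j : T) = y := by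
    intro y
    simp only [L, Finset.mem_toList, Finset.mem_image, Finset.mem_erase, Subring.subtype_apply]
    tauto
  have hcL : (c : T) ∈ Ideal.span {y | y ∈ L} := by
    rw [Ideal.map_span] at hc
    refine Ideal.span_le.2 ?_ hc
    rintro _ ⟨j, hj, rfl⟩
    by_cases hj0 : j = 0
    · rw [hj0, map_zero]
      exact zero_mem _
    · exact Ideal.subset_span ((hL _).2 ⟨j, hj, hj0, rfl⟩)
  refine Subring.IsCombination.mem (L := L) (fun y hy => ?_) (hD (Sum.inr (Sum.inl (L, c))) ?_ ?_
    (Subring.isCombination_of_mem_span hcL))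
  · obtain ⟨j, hj, -, rfl⟩ := (hL y).1 hy
    exact ⟨j, Ideal.subset_span hj, rfl⟩
  · refine Set.insert_subset c.2 fun y hy => ?_
    obtain ⟨j, -, -, rfl⟩ := (hL y).1 hy
    exact j.2
  · rintro y hy rfl
    obtain ⟨j, -, hj0, hj⟩ := (hL 0).1 hy
    exact hj0 (Subtype.ext hj)

end TransfiniteConstruction

theorem weaklyFRegular_of_subset_avoidingSet {T : Type*} [CommRing T] [IsLocalRing T]
    [IsNoetherianRing T] (p : ℕ) [Fact p.Prime] [CharP T p] {I : ℕ → Ideal T}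
    (hI : IsApproxGorensteinSeq T I) {y : ℕ → T} (hy : ∀ s, IsSocleGenerator (I s) (y s))
    {P : Ideal T} (h2 : ∀ s, MIy p (I s) (y s) ⊆ (P : Set T)) {C : Set (Ideal T)} (hPC : P ∈ C)
    {A : Subring T} [IsDomain A] [IsNoetherianRing A] (hA : (A : Set T) ⊆ avoidingSet C)
    (hcl : ∀ J : Ideal A, J.FG → ∀ c : A, (c : T) ∈ J.map A.subtype → c ∈ J) :
    WeaklyFRegular A p := by
  rintro J x ⟨c, hc, E, hE⟩
  by_contra hx
  have hxJ : (x : T) ∉ J.map A.subtype := fun h =>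
    hx (hcl J (IsNoetherian.noetherian J) x h)
  obtain ⟨s, hs⟩ := exists_mem_MIy_of_notMem p hI hy hxJ (c := (c : T)) (E := E) fun e he =>
    Ideal.map_frobPow_le A.subtype (fun a ha => Ideal.mem_map_of_mem _ ha) (hE e he)
  have hc0 : c = 0 := Subtype.ext (hA c.2 P hPC (h2 s hs))
  exact hc ⊥ (by simp [IsDomain.minimalPrimes_eq_singleton_bot]) (by simp [hc0])

theorem closure_empty_subset_avoidingSet {T : Type*} [CommRing T] (p : ℕ) [Fact p.Prime]
    [CharP T p] {C : Set (Ideal T)} (hprime : ∀ Q ∈ C, Q.IsPrime) :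
    ((Subring.closure ∅ : Subring T) : Set T) ⊆ avoidingSet C := by
  intro x hx Q hQ hxQ
  rw [Subring.closure_empty] at hx
  obtain ⟨a, rfl⟩ := Subring.mem_bot.1 hx
  by_contra h0
  refine (hprime Q hQ).ne_top (Q.eq_top_of_isUnit_mem hxQ
    ((CharP.isUnit_intCast_iff (p := p) Fact.out).2 fun h => h0 ?_))
  exact (CharP.intCast_eq_zero_iff T p a).2 h

theorem exists_mem_maximalIdeal_forall_notMem {T : Type*} [CommRing T] [IsLocalRing T]
    {C : Set (Ideal T)} (hfin : C.Finite) (hprime : ∀ Q ∈ C, Q.IsPrime)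
    (hC : maximalIdeal T ∉ C) : ∃ z ∈ maximalIdeal T, ∀ Q ∈ C, z ∉ Q := by
  by_contra! hcon
  have hsub : (maximalIdeal T : Set T) ⊆ ⋃ Q ∈ C, (Q : Set T) := fun z hz =>
    Set.mem_iUnion₂.2 (by simpa using hcon z hz)
  obtain ⟨Q, hQ, hle⟩ := (Ideal.subset_union_prime_finite hfin (f := id) ⊥ ⊥
    fun Q hQ _ _ => hprime Q hQ).1 hsub
  have := (maximalIdeal.isMaximal T).eq_of_le (hprime Q hQ).ne_top hle
  exact hC (this ▸ hQ)

theorem mem_nonZeroDivisors_of_forall_notMem_minimalPrimes {T : Type*} [CommRing T] [IsReduced T]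
    {a : T} (ha : ∀ Q ∈ minimalPrimes T, a ∉ Q) : a ∈ nonZeroDivisors T := by
  rw [mem_nonZeroDivisors_iff_right]
  intro b hb
  have hmem : b ∈ sInf (minimalPrimes T) := by
    rw [Submodule.mem_sInf]
    intro Q hQ
    exact (hQ.1.1.mem_or_mem (show b * a ∈ Q from hb ▸ Q.zero_mem)).resolve_right (ha Q hQ)
  rw [minimalPrimes, Ideal.sInf_minimalPrimes] at hmem
  exact (mem_nilradical.1 hmem).eq_zero

theorem maximalIdeal_notMem_minimalPrimes {T : Type*} [CommRing T] [IsLocalRing T]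
    (hdim : 0 < ringKrullDim T) : maximalIdeal T ∉ minimalPrimes T := by
  intro h
  have : Ring.KrullDimLE 0 T := Ring.krullDimLE_zero_iff.2 fun Q hQ => by
    have := h.2 ⟨hQ, bot_le⟩ (le_maximalIdeal hQ.ne_top)
    rw [le_antisymm (le_maximalIdeal hQ.ne_top) this]
    exact maximalIdeal.isMaximal T
  exact hdim.not_ge (Ring.krullDimLE_iff.1 this)

/-- Weakly F-regular precompletions of complete local reduced rings. -/
theorem weaklyFRegular_precompletion
    (T : Type*) [CommRing T] [IsLocalRing T] [IsNoetherianRing T]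
    [IsAdicComplete (maximalIdeal T) T] [IsReduced T]
    (p : ℕ) (hp : p.Prime) [CharP T p]
    (hdim : 2 ≤ ringKrullDim T)
    (I : ℕ → Ideal T) (hI : IsApproxGorensteinSeq T I)
    (y : ℕ → T) (hy : ∀ s, IsSocleGenerator (I s) (y s))
    (h1 : ∀ s e : ℕ, y s ^ p ^ e ∉ (I s).frobPow (p ^ e))
    (P : Ideal T) (hP : P.IsPrime) (hPm : P ≠ maximalIdeal T)
    (h2 : ∀ s, MIy p (I s) (y s) ⊆ (P : Set T)) :
    (∃ (A : Subring T) (_ : IsDomain A),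
        IsNoetherianRing A ∧ IsLocalRing A ∧
        (Ideal.comap A.subtype (maximalIdeal T)).IsMaximal ∧
        WeaklyFRegular A p ∧
        Nonempty (AdicCompletion (Ideal.comap A.subtype (maximalIdeal T)) A ≃+* T)) ∧
    ∀ v : ℕ → T,
      (∀ i, v i ∈ nonZeroDivisors T ∧ v i ∈ maximalIdeal T ∧ v i ∉ P) →
      ∃ (A : Subring T) (_ : IsDomain A),
        IsNoetherianRing A ∧ IsLocalRing A ∧
        (Ideal.comap A.subtype (maximalIdeal T)).IsMaximal ∧
        WeaklyFRegular A p ∧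
        Nonempty (AdicCompletion (Ideal.comap A.subtype (maximalIdeal T)) A ≃+* T) ∧
        ∀ i, ∃ t : Tˣ, v i * (t : T) ∈ A := by
  have := Fact.mk hp
  let C : Set (Ideal T) := insert P (minimalPrimes T)
  have hfin : C.Finite := (minimalPrimes.finite_of_isNoetherianRing T).insert P
  have hprime : ∀ Q ∈ C, Q.IsPrime := by
    rintro Q (rfl | hQ)
    exacts [hP, hQ.1.1]
  have hmC : maximalIdeal T ∉ C := by
    rintro (h | h)
    exacts [hPm h.symm,
      maximalIdeal_notMem_minimalPrimes (lt_of_lt_of_le (by norm_num) hdim) h]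
  have hreg : ∀ a : T, (∀ Q ∈ C, a ∉ Q) → a ∈ nonZeroDivisors T := fun a ha =>
    mem_nonZeroDivisors_of_forall_notMem_minimalPrimes fun Q hQ => ha Q (Or.inr hQ)
  obtain ⟨z, hz, hzC⟩ := exists_mem_maximalIdeal_forall_notMem hfin hprime hmC
  have key : ∀ v : ℕ → T,
      (∀ i, v i ∈ nonZeroDivisors T ∧ v i ∈ maximalIdeal T ∧ v i ∉ P) →
      ∃ (A : Subring T) (_ : IsDomain A),
        IsNoetherianRing A ∧ IsLocalRing A ∧
        (Ideal.comap A.subtype (maximalIdeal T)).IsMaximal ∧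
        WeaklyFRegular A p ∧
        Nonempty (AdicCompletion (Ideal.comap A.subtype (maximalIdeal T)) A ≃+* T) ∧
        ∀ i, ∃ t : Tˣ, v i * (t : T) ∈ A := by
    intro v hv
    have hvC : ∀ i, ∀ Q ∈ C, v i ∉ Q := by
      rintro i Q (rfl | hQ) h
      · exact (hv i).2.2 h
      · exact notMem_nonZeroDivisors_of_mem_mem_minimalPrimes h hQ (hv i).1
    obtain ⟨A, hA, hsurj, hcl, hvA⟩ := Subring.exists_fg_closed_subset_avoidingSet hfin hprime hz
      hzC hreg (closure_empty_subset_avoidingSet p hprime) v hvC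
    have hinj : Function.Injective ((Ideal.Quotient.mk P).comp A.subtype) := by
      rw [injective_iff_map_eq_zero]
      intro x hx
      exact Subtype.ext (hA x.2 P (Or.inl rfl) (Ideal.Quotient.eq_zero_iff_mem.1 hx))
    have hdom : IsDomain A := hinj.isDomain _
    have hnoeth : IsNoetherianRing A := Subring.isNoetherianRing_of_fg_closed hcl
    exact ⟨A, hdom, hnoeth, Subring.isLocalRing_of_fg_closed hcl,
      Subring.isMaximal_comap_of_fg_closed hcl,
      weaklyFRegular_of_subset_avoidingSet p hI hy h2 (Or.inl rfl) hA hcl,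
      Subring.nonempty_adicCompletion_ringEquiv hsurj hcl, hvA⟩
  refine ⟨?_, key⟩
  obtain ⟨A, hdom, hnoeth, hloc, hmax, hwf, hcompl, -⟩ := key (fun _ => z) fun _ =>
    ⟨hreg z hzC, hz, hzC P (Or.inl rfl)⟩
  exact ⟨A, hdom, hnoeth, hloc, hmax, hwf, hcompl⟩
end
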